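/- arXiv:2001.08315 — 9 statements merged into one kernel-verified Lean document; each statement's English description precedes it below -/
import Mathlib

section
/- Let N ≥ 2 and γ ≥ 0 be integers and let S be an (N,γ)-hyperelliptic numerical semigroup of genus g. Let q ∈ {0,…,N−2} be the residue of g − γ modulo N − 1. Then, as integers, 2(N−1)·W_S ≥ (g − Nγ − N + 1 + q)·(g − Nγ − q). -/
/-- A numerical semigroup: a subset of ℕ containing 0, closed under addition,
with finite complement. -/
def IsNumericalSemigroup (S : Set ℕ) : Prop :=
  0 ∈ S ∧ (∀ a ∈ S, ∀ b ∈ S, a + b ∈ S) ∧ Sᶜ.Finite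

/-- The genus of a numerical semigroup: the number of gaps. -/
noncomputable def genus (S : Set ℕ) : ℕ := Sᶜ.ncard

/-- The weight of a numerical semigroup of genus g: writing the gaps as
ℓ_1 < ⋯ < ℓ_g, it is Σ (ℓ_i − i) = (Σ ℓ_i) − g(g+1)/2. -/
noncomputable def weight (S : Set ℕ) : ℤ :=
  (∑ᶠ ℓ ∈ Sᶜ, (ℓ : ℤ)) - (genus S * (genus S + 1)) / 2

/-- S is (N,γ)-hyperelliptic: the γ smallest positive elements of S are
n_1 < ⋯ < n_γ, all multiples of N with n_γ = 2γN, and (2γ+1)N ∈ S. -/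
def IsNgammaHyperelliptic (N γ : ℕ) (S : Set ℕ) : Prop :=
  IsNumericalSemigroup S ∧
  {s ∈ S | 0 < s ∧ s ≤ 2 * γ * N}.ncard = γ ∧
  (∀ s ∈ S, 0 < s → s ≤ 2 * γ * N → N ∣ s) ∧
  2 * γ * N ∈ S ∧
  (2 * γ + 1) * N ∈ S

open Finset in
theorem two_mul_sum_card_filter_le (G : Finset ℕ) :
    2 * ∑ x ∈ G, #{y ∈ G | y ≤ x} = #G * (#G + 1) := by
  induction G using Finset.induction_on_max with
  | empty => simp
  | insert a s ha ih =>
    have has : a ∉ s := fun h => lt_irrefl _ (ha a h)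
    have h1 : {y ∈ insert a s | y ≤ a} = insert a s := by
      refine filter_true_of_mem fun y hy => ?_
      rcases mem_insert.1 hy with rfl | hy
      · exact le_rfl
      · exact (ha y hy).le
    have h2 : ∀ x ∈ s, #{y ∈ insert a s | y ≤ x} = #{y ∈ s | y ≤ x} := fun x hx => by
      rw [filter_insert, if_neg (not_le.2 (ha x hx))]
    rw [sum_insert has, h1, sum_congr rfl h2, card_insert_of_notMem has, mul_add, ih]
    ring

open Finset Classical in
/-- The weight counts the pairs formed by a gap and a smaller positive element. -/
theorem weight_eq_sum_card {S : Set ℕ} (hS : IsNumericalSemigroup S) :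
    weight S = ∑ l ∈ hS.2.2.toFinset, (#{s ∈ Ioc 0 l | s ∈ S} : ℤ) := by
  set G := hS.2.2.toFinset with hG
  have hmem : ∀ x, x ∈ G ↔ x ∉ S := fun x => by simp [hG]
  have hgen : genus S = #G := Set.ncard_eq_toFinset_card _ hS.2.2
  have hsum : ∑ᶠ l ∈ Sᶜ, (l : ℤ) = ∑ l ∈ G, (l : ℤ) :=
    finsum_mem_eq_finite_toFinset_sum _ hS.2.2
  have hl : ∀ l ∈ G, (l : ℤ) = #{s ∈ Ioc 0 l | s ∈ S} + #{y ∈ G | y ≤ l} := by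
    intro l _
    have h1 := card_filter_add_card_filter_not (s := Ioc 0 l) (fun s => s ∈ S)
    have h2 : {s ∈ Ioc 0 l | s ∉ S} = {y ∈ G | y ≤ l} := by
      ext y
      have h0 : y ∉ S → 0 < y := fun h => Nat.pos_of_ne_zero fun h' => h (h' ▸ hS.1)
      simp only [mem_filter, mem_Ioc, hmem]
      tauto
    rw [h2, Nat.card_Ioc] at h1
    omega
  have h2 : (2 : ℤ) * ∑ x ∈ G, (#{y ∈ G | y ≤ x} : ℤ) = #G * (#G + 1) :=
    mod_cast two_mul_sum_card_filter_le G
  rw [weight, hgen, hsum, sum_congr rfl hl, sum_add_distrib, ← h2]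
  simp

open Finset Classical in
/-- If `T` is closed under addition, has at most `γ` gaps up to `2 * γ`, and contains
`2 * γ + 1`, then it has at most `γ` positive gaps. -/
theorem card_gaps_le {T : Set ℕ} {γ : ℕ} (hadd : ∀ a ∈ T, ∀ b ∈ T, a + b ∈ T)
    (hcard : #{t ∈ Ioc 0 (2 * γ) | t ∉ T} ≤ γ) (h1 : 2 * γ + 1 ∈ T) (m : ℕ) :
    #{t ∈ Ioc 0 m | t ∉ T} ≤ γ := by
  have key : ∀ k, #{t ∈ Ioc 0 (2 * γ + k) | t ∉ T} ≤ γ := by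
    intro k
    induction k with
    | zero => exact hcard
    | succ k ih =>
      have hT : 2 * γ + (k + 1) ∈ T := by
        rcases Nat.eq_zero_or_pos k with rfl | hk
        · exact h1
        by_contra hn
        set A := {t ∈ Ioc 0 (2 * γ + k) | t ∉ T} with hA
        have hsub : Ioc 0 (2 * γ + k) ⊆ A ∪ A.image (fun t => 2 * γ + (k + 1) - t) := by
          intro x hx
          by_cases hxT : x ∈ T
          · refine mem_union_right _ (mem_image.2 ⟨2 * γ + (k + 1) - x, ?_, ?_⟩)
            · rw [mem_Ioc] at hx
              refine mem_filter.2 ⟨mem_Ioc.2 (by omega), fun h => hn ?_⟩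
              have := hadd _ hxT _ h
              rwa [Nat.add_sub_cancel' (by omega)] at this
            · rw [mem_Ioc] at hx
              omega
          · exact mem_union_left _ (mem_filter.2 ⟨hx, hxT⟩)
        have h2 := (card_le_card hsub).trans (card_union_le _ _)
        have h3 := card_image_le (s := A) (f := fun t => 2 * γ + (k + 1) - t)
        rw [Nat.card_Ioc] at h2
        omega
      refine (card_le_card fun x hx => ?_).trans ih
      simp only [mem_filter, mem_Ioc] at hx ⊢
      have : x ≠ 2 * γ + (k + 1) := fun h => hx.2 (h ▸ hT)
      exact ⟨by omega, hx.2⟩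
  refine (card_le_card fun x hx => ?_).trans (key m)
  simp only [mem_filter, mem_Ioc] at hx ⊢
  exact ⟨by omega, hx.2⟩

open Finset in
theorem sum_range_not_dvd_div (M a : ℕ) (h : ℕ → ℤ) :
    ∑ l ∈ range ((M + 1) * a) with ¬ (M + 1) ∣ l, h (l / (M + 1)) = M * ∑ m ∈ range a, h m := by
  induction a with
  | zero => simp
  | succ a ih =>
    rw [sum_filter] at ih ⊢
    rw [mul_add, mul_one, sum_range_add, ih, sum_range_succ', sum_range_succ, mul_add]
    congr 1
    have : ∀ x ∈ range M, (if ¬ (M + 1) ∣ (M + 1) * a + (x + 1) then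
        h (((M + 1) * a + (x + 1)) / (M + 1)) else 0) = h a := by
      intro x hx
      rw [mem_range] at hx
      rw [if_pos, Nat.mul_add_div (Nat.succ_pos M), Nat.div_eq_of_lt (by omega), add_zero]
      rw [Nat.dvd_add_right (Dvd.intro _ rfl)]
      exact Nat.not_dvd_of_pos_of_lt (Nat.succ_pos x) (by omega)
    rw [sum_congr rfl this]
    simp

open Finset in
/-- A monotone function of `l / (M + 1)`, summed over a set `D` of non-multiples of `M + 1`, is
smallest when `D` consists of the smallest non-multiples. -/
theorem le_sum_div_of_not_dvd {M a q : ℕ} {f : ℕ → ℤ} (hf : Monotone f) (hf0 : ∀ m, 0 ≤ f m)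
    {D : Finset ℕ} (hD : ∀ l ∈ D, ¬ (M + 1) ∣ l) (hcard : M * a + q ≤ #D) :
    M * ∑ m ∈ range a, f m + q * f a ≤ ∑ l ∈ D, f (l / (M + 1)) := by
  set E := {l ∈ range ((M + 1) * a) | ¬ (M + 1) ∣ l} with hE
  have hlt : ∀ l, l ∈ range ((M + 1) * a) ↔ l / (M + 1) < a := fun l => by
    rw [mem_range, Nat.div_lt_iff_lt_mul (Nat.succ_pos M), mul_comm]
  have h1 : ∑ l ∈ D, (f a - f (l / (M + 1))) ≤ ∑ l ∈ E, (f a - f (l / (M + 1))) := by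
    calc ∑ l ∈ D, (f a - f (l / (M + 1)))
        ≤ ∑ l ∈ D with l / (M + 1) < a, (f a - f (l / (M + 1))) := by
          rw [sum_filter]
          refine sum_le_sum fun l _ => ?_
          split_ifs with h
          · exact le_rfl
          · exact sub_nonpos.2 (hf (not_lt.1 h))
      _ ≤ _ := by
          refine sum_le_sum_of_subset_of_nonneg (fun l hl => ?_) fun l hl _ => ?_
          · rw [mem_filter] at hl
            exact mem_filter.2 ⟨(hlt l).2 hl.2, hD l hl.1⟩
          · exact sub_nonneg.2 (hf ((hlt l).1 (mem_filter.1 hl).1).le)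
  rw [hE, sum_range_not_dvd_div M a fun m => f a - f m] at h1
  simp only [sum_sub_distrib, sum_const, card_range, nsmul_eq_mul] at h1
  have h2 : ((M * a + q : ℕ) : ℤ) * f a ≤ #D * f a :=
    mul_le_mul_of_nonneg_right (mod_cast hcard) (hf0 a)
  push_cast at h2
  linarith

open Finset in
theorem two_mul_sum_range_tsub (γ b : ℕ) :
    2 * ∑ m ∈ range (γ + b), ((m - γ : ℕ) : ℤ) = b * (b - 1) := by
  induction b with
  | zero =>
    rw [sum_eq_zero fun m hm => ?_]
    · simp
    · rw [add_zero, mem_range] at hm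
      simp [Nat.sub_eq_zero_of_le hm.le]
  | succ b ih =>
    rw [← add_assoc, sum_range_succ, mul_add, ih, Nat.add_sub_cancel_left]
    push_cast
    ring

open Finset Classical in
theorem IsNgammaHyperelliptic.card_filter_mul_mem {N γ : ℕ} {S : Set ℕ} (hN : 0 < N)
    (hS : IsNgammaHyperelliptic N γ S) : #{t ∈ Ioc 0 (2 * γ) | t * N ∈ S} = γ := by
  obtain ⟨-, hcard, hdvd, -, -⟩ := hS
  have : {s ∈ S | 0 < s ∧ s ≤ 2 * γ * N} =
      (({t ∈ Ioc 0 (2 * γ) | t * N ∈ S}.image (· * N) : Finset ℕ) : Set ℕ) := by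
    ext s
    simp only [Set.mem_ofPred_eq, coe_image, Set.mem_image, mem_coe, mem_filter, mem_Ioc]
    constructor
    · rintro ⟨hs, h0, hle⟩
      obtain ⟨t, rfl⟩ := hdvd s hs h0 hle
      rw [mul_comm N t] at *
      exact ⟨t, ⟨⟨Nat.pos_of_mul_pos_right h0, Nat.le_of_mul_le_mul_right hle hN⟩, hs⟩, rfl⟩
    · rintro ⟨t, ⟨⟨h0, hle⟩, hs⟩, rfl⟩
      exact ⟨hs, Nat.mul_pos h0 hN, Nat.mul_le_mul_right N hle⟩
  rw [this, Set.ncard_coe_finset,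
    card_image_of_injective _ (mul_left_injective₀ hN.ne')] at hcard
  exact hcard

open Finset Classical in
theorem IsNgammaHyperelliptic.card_gaps_mul_le {N γ : ℕ} {S : Set ℕ} (hN : 0 < N)
    (hS : IsNgammaHyperelliptic N γ S) (m : ℕ) : #{t ∈ Ioc 0 m | t * N ∉ S} ≤ γ := by
  have hc := hS.card_filter_mul_mem hN
  have h := card_filter_add_card_filter_not (s := Ioc 0 (2 * γ)) (fun t => t * N ∈ S)
  rw [Nat.card_Ioc] at h
  refine card_gaps_le (T := {t | t * N ∈ S}) (fun a ha b hb => ?_) ?_ hS.2.2.2.2 m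
  · change (a + b) * N ∈ S
    rw [add_mul]
    exact hS.1.2.1 _ ha _ hb
  · change #{t ∈ Ioc 0 (2 * γ) | t * N ∉ S} ≤ γ
    omega

open Finset Classical in
theorem IsNgammaHyperelliptic.div_sub_le_card {N γ : ℕ} {S : Set ℕ} (hN : 0 < N)
    (hS : IsNgammaHyperelliptic N γ S) (l : ℕ) : l / N - γ ≤ #{s ∈ Ioc 0 l | s ∈ S} := by
  have hg := hS.card_gaps_mul_le hN (l / N)
  have h := card_filter_add_card_filter_not (s := Ioc 0 (l / N)) (fun t => t * N ∈ S)
  rw [Nat.card_Ioc] at h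
  have : #{t ∈ Ioc 0 (l / N) | t * N ∈ S} ≤ #{s ∈ Ioc 0 l | s ∈ S} := by
    refine card_le_card_of_injOn (· * N) (fun t ht => ?_) (mul_left_injective₀ hN.ne').injOn
    simp only [coe_filter, mem_Ioc, Set.mem_ofPred_eq] at ht ⊢
    exact ⟨⟨Nat.mul_pos ht.1.1 hN, (Nat.le_div_iff_mul_le hN).1 ht.1.2⟩, ht.2⟩
  omega

open Finset in
theorem IsNgammaHyperelliptic.card_gaps_dvd_le {N γ : ℕ} {S : Set ℕ} (hN : 0 < N)
    (hS : IsNgammaHyperelliptic N γ S) : #{l ∈ hS.1.2.2.toFinset | N ∣ l} ≤ γ := by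
  classical
  set G := hS.1.2.2.toFinset with hG
  refine le_trans ?_ (hS.card_gaps_mul_le hN (G.sup id))
  refine card_le_card_of_injOn (· / N) (fun l hl => ?_) (fun x hx y hy hxy => ?_)
  · simp only [coe_filter, Set.mem_ofPred_eq, mem_Ioc] at hl ⊢
    have hlS : l ∉ S := by simpa [hG] using hl.1
    have h0 : 0 < l := Nat.pos_of_ne_zero fun h => hlS (h ▸ hS.1.1)
    rw [Nat.div_mul_cancel hl.2]
    exact ⟨⟨Nat.div_pos (Nat.le_of_dvd h0 hl.2) hN,
      (Nat.div_le_self l N).trans (le_sup (f := id) hl.1)⟩, hlS⟩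
  · exact Nat.div_left_inj (mem_filter.1 hx).2 (mem_filter.1 hy).2 |>.1 hxy

open Finset in
theorem IsNgammaHyperelliptic.le_genus_add {N γ : ℕ} {S : Set ℕ}
    (hS : IsNgammaHyperelliptic N γ S) : 2 * γ * N ≤ genus S + γ := by
  classical
  have h := card_filter_add_card_filter_not (s := Ioc 0 (2 * γ * N)) (fun s => s ∈ S)
  have h1 : #{s ∈ Ioc 0 (2 * γ * N) | s ∈ S} = γ := by
    rw [← Set.ncard_coe_finset]
    refine Eq.trans (congrArg Set.ncard ?_) hS.2.1
    ext s
    simp only [Finset.coe_filter, mem_Ioc, Set.mem_ofPred_eq]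
    tauto
  have h2 : #{s ∈ Ioc 0 (2 * γ * N) | s ∉ S} ≤ genus S := by
    rw [genus, Set.ncard_eq_toFinset_card _ hS.1.2.2]
    exact card_le_card fun s hs => by simpa using (mem_filter.1 hs).2
  rw [Nat.card_Ioc] at h
  omega

/-- lower weight bound for (N,γ)-hyperelliptic semigroups. -/
theorem stmt1 (N γ g : ℕ) (hN : 2 ≤ N) (S : Set ℕ)
    (hS : IsNgammaHyperelliptic N γ S) (hg : genus S = g)
    (q : ℤ) (hq : q = ((g : ℤ) - γ) % ((N : ℤ) - 1)) :
    2 * ((N : ℤ) - 1) * weight S ≥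
      ((g : ℤ) - N * γ - N + 1 + q) * ((g : ℤ) - N * γ - q) := by
  classical
  obtain ⟨M, rfl⟩ : ∃ M, N = M + 1 := ⟨N - 1, by omega⟩
  have hN0 : 0 < M + 1 := Nat.succ_pos M
  have hM : 0 < M := by omega
  have hgle := hS.le_genus_add
  rw [hg] at hgle
  have hgle' : M * γ + γ ≤ g := by nlinarith
  obtain ⟨b, r, hr, hgb⟩ : ∃ b r : ℕ, r < M ∧ g = γ + M * (γ + b) + r := by
    refine ⟨(g - γ - M * γ) / M, (g - γ - M * γ) % M, Nat.mod_lt _ hM, ?_⟩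
    have := Nat.div_add_mod (g - γ - M * γ) M
    rw [mul_add]
    omega
  have hqr : q = r := by
    have h1 : (g : ℤ) - γ = r + M * (γ + b) := by rw [hgb]; push_cast; ring
    rw [hq, h1]
    push_cast
    rw [add_sub_cancel_right, Int.add_mul_emod_self_left]
    exact Int.emod_eq_of_lt (by positivity) (mod_cast hr)
  set G := hS.1.2.2.toFinset with hG
  have hcardG : G.card = g := by rw [← hg, genus, Set.ncard_eq_toFinset_card _ hS.1.2.2]
  have hdvd : {l ∈ G | (M + 1) ∣ l}.card ≤ γ := hS.card_gaps_dvd_le hN0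
  have hsplit := G.card_filter_add_card_filter_not (fun l => (M + 1) ∣ l)
  have hbound := le_sum_div_of_not_dvd (M := M) (a := γ + b) (q := r)
    (f := fun m => ((m - γ : ℕ) : ℤ)) (D := {l ∈ G | ¬ (M + 1) ∣ l})
    (fun x y hxy => Nat.cast_le.2 <| Nat.sub_le_sub_right hxy γ) (fun m => by positivity)
    (fun l hl => (Finset.mem_filter.1 hl).2) (by omega)
  have hweight : ∑ l ∈ G with ¬ (M + 1) ∣ l, ((l / (M + 1) - γ : ℕ) : ℤ) ≤ weight S := by
    rw [weight_eq_sum_card hS.1]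
    refine (Finset.sum_le_sum fun l _ => Nat.cast_le.2 (hS.div_sub_le_card hN0 l)).trans ?_
    exact Finset.sum_le_sum_of_subset_of_nonneg (Finset.filter_subset _ _)
      fun l _ _ => by positivity
  have hsum := two_mul_sum_range_tsub γ b
  rw [Nat.add_sub_cancel_left] at hbound
  have hfin := mul_le_mul_of_nonneg_left (hbound.trans hweight) (by positivity : (0 : ℤ) ≤ 2 * M)
  rw [hqr, hgb]
  push_cast
  rw [add_sub_cancel_right, ge_iff_le]
  refine le_trans (le_of_eq ?_) hfin
  linear_combination (-(M : ℤ) ^ 2) * hsum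
end

section
/- Let γ ≥ 0 and let S be a (2,γ)-hyperelliptic numerical semigroup of genus g with g ≥ 2γ. Then binom(g−2γ,2) ≤ W_S ≤ binom(g−2γ,2) + 2γ². -/
theorem two_mul_choose_two_cast (n : ℕ) : 2 * (n.choose 2 : ℤ) = n * (n - 1) := by
  induction n with
  | zero => simp
  | succ n ih =>
    rw [Nat.choose_succ_succ' n 1, Nat.choose_one_right]
    push_cast
    linarith

/-- The ranks of the elements of a finite set of naturals, counted from `0`, sum to `#A choose 2`. -/
theorem Finset.sum_card_filter_lt (A : Finset ℕ) :
    ∑ x ∈ A, (A.filter (· < x)).card = A.card.choose 2 := by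
  induction A using Finset.induction_on_max with
  | empty => simp
  | insert a A ha ih =>
    have haA : a ∉ A := fun h => lt_irrefl _ (ha a h)
    rw [Finset.sum_insert haA, Finset.card_insert_of_notMem haA, Nat.choose_succ_succ' A.card 1,
      Nat.choose_one_right, ← ih]
    congr 1
    · congr 1
      ext y
      simp only [Finset.mem_filter, Finset.mem_insert]
      grind
    · refine Finset.sum_congr rfl fun x hx => ?_
      congr 1
      ext y
      simp only [Finset.mem_filter, Finset.mem_insert]
      grind

theorem Finset.card_filter_le_eq_succ {A : Finset ℕ} {x : ℕ} (hx : x ∈ A) :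
    (A.filter (· ≤ x)).card = (A.filter (· < x)).card + 1 := by
  rw [← Finset.card_insert_of_notMem (a := x) (by simp)]
  congr 1
  ext y
  simp only [Finset.mem_filter, Finset.mem_insert]
  grind

theorem Finset.choose_two_card_le_sum (A : Finset ℕ) : A.card.choose 2 ≤ ∑ x ∈ A, x := by
  rw [← A.sum_card_filter_lt]
  refine Finset.sum_le_sum fun x _ => ?_
  calc (A.filter (· < x)).card ≤ (Finset.range x).card :=
        Finset.card_le_card fun y hy => by simp_all
    _ = x := by simp

theorem Finset.choose_two_card_add_card_le_sum {A : Finset ℕ} (h0 : 0 ∉ A) :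
    A.card.choose 2 + A.card ≤ ∑ x ∈ A, x := by
  rw [← A.sum_card_filter_lt, Finset.card_eq_sum_ones A, ← Finset.sum_add_distrib]
  refine Finset.sum_le_sum fun x hx => ?_
  rw [← Finset.card_filter_le_eq_succ hx]
  calc (A.filter (· ≤ x)).card ≤ (Finset.Icc 1 x).card :=
        Finset.card_le_card fun y hy => by
          simp only [Finset.mem_filter, Finset.mem_Icc] at hy ⊢
          have : y ≠ 0 := fun h => h0 (h ▸ hy.1)
          lia
    _ = x := by simp

/-- If `A ⊆ G` is stable under subtracting elements outside `G`, the excess of `∑ A` over its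
minimal possible value `#A choose 2` is at most `(#G + 1) choose 2`. -/
theorem Finset.sum_le_of_sub_mem {A G : Finset ℕ} (hAG : A ⊆ G)
    (h : ∀ x ∈ A, ∀ t ≤ x, t ∉ G → x - t ∈ A) :
    ∑ x ∈ A, x ≤ A.card.choose 2 + (G.card.choose 2 + G.card) := by
  have key : ∀ x ∈ A, x ≤ (A.filter (· < x)).card + (G.filter (· ≤ x)).card := by
    intro x hx
    have hsplit := Finset.card_filter_add_card_filter_not (s := Finset.range (x + 1)) (· ∈ G)
    rw [Finset.card_range] at hsplit
    have hG : ((Finset.range (x + 1)).filter (· ∈ G)).card ≤ (G.filter (· ≤ x)).card :=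
      Finset.card_le_card fun y hy => by
        simp only [Finset.mem_filter, Finset.mem_range] at hy ⊢
        exact ⟨hy.2, by lia⟩
    have hA : ((Finset.range (x + 1)).filter (· ∉ G)).card ≤ (A.filter (· ≤ x)).card := by
      refine Finset.card_le_card_of_injOn (x - ·) ?_ ?_
      · intro y hy
        simp only [Finset.coe_filter, Finset.mem_range, Set.mem_ofPred_eq] at hy ⊢
        exact ⟨h x hx y (by lia) hy.2, by lia⟩
      · intro y hy z hz hyz
        simp only [Finset.coe_filter, Finset.mem_range, Set.mem_ofPred_eq] at hy hz hyz
        lia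
    rw [Finset.card_filter_le_eq_succ hx] at hA
    lia
  calc ∑ x ∈ A, x
      ≤ ∑ x ∈ A, (A.filter (· < x)).card + ∑ x ∈ A, (G.filter (· ≤ x)).card := by
        rw [← Finset.sum_add_distrib]
        exact Finset.sum_le_sum key
    _ ≤ A.card.choose 2 + ∑ x ∈ G, (G.filter (· ≤ x)).card := by
        rw [A.sum_card_filter_lt]
        gcongr
    _ = A.card.choose 2 + (G.card.choose 2 + G.card) := by
        rw [Finset.sum_congr rfl fun x hx => Finset.card_filter_le_eq_succ hx,
          Finset.sum_add_distrib, G.sum_card_filter_lt, Finset.card_eq_sum_ones G]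

/-- An additively closed set containing `2γ + 1` and `γ` elements of `[1, 2γ]`
contains every `n > 2γ`. -/
theorem mem_of_two_mul_lt {T : Set ℕ} {γ : ℕ} (hadd : ∀ a ∈ T, ∀ b ∈ T, a + b ∈ T)
    {P : Finset ℕ} (hP : ∀ y, y ∈ P ↔ y ∈ T ∧ 0 < y ∧ y ≤ 2 * γ) (hcard : P.card = γ)
    (hsucc : 2 * γ + 1 ∈ T) (n : ℕ) (hn : 2 * γ < n) : n ∈ T := by
  induction n using Nat.strong_induction_on with
  | _ n ih =>
    by_contra hnT
    have hne : n ≠ 2 * γ + 1 := fun h => hnT (h ▸ hsucc)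
    rcases Nat.eq_zero_or_pos γ with rfl | hγ
    · have := hadd _ (ih (n - 1) (by lia) (by lia)) _ hsucc
      rw [show n - 1 + (2 * 0 + 1) = n by lia] at this
      exact hnT this
    have hsub : ∀ y ∈ P, n - y ∉ T := fun y hy h => by
      have hy' := (hP y).1 hy
      have := hadd _ h _ hy'.1
      rw [Nat.sub_add_cancel (by lia)] at this
      exact hnT this
    have hle : ∀ y ∈ P, n - y ≤ 2 * γ := fun y hy => by
      by_contra hlt
      have hy' := (hP y).1 hy
      exact hsub y hy (ih _ (by lia) (by lia))
    have hdisj : Disjoint P (P.image (n - ·)) := by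
      rw [Finset.disjoint_left]
      intro y hy hy'
      obtain ⟨z, hz, rfl⟩ := Finset.mem_image.1 hy'
      exact hsub z hz ((hP _).1 hy).1
    have himg : (P.image (n - ·)).card = γ := by
      rw [Finset.card_image_of_injOn, hcard]
      intro y hy z hz hyz
      have hy' := (hP y).1 hy
      have hz' := (hP z).1 hz
      simp only at hyz
      lia
    have hsubset : P ∪ P.image (n - ·) ⊆ Finset.Icc (n - 2 * γ) (2 * γ) := by
      intro y hy
      rw [Finset.mem_Icc]
      rcases Finset.mem_union.1 hy with hy | hy
      · have hy' := (hP y).1 hy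
        have := hle y hy
        lia
      · obtain ⟨z, hz, rfl⟩ := Finset.mem_image.1 hy
        have hz' := (hP z).1 hz
        have := hle z hz
        lia
    have := Finset.card_le_card hsubset
    rw [Finset.card_union_of_disjoint hdisj, hcard, himg, Nat.card_Icc] at this
    lia

/-- The set of halves of the even gaps of a `(2, γ)`-hyperelliptic semigroup has `γ` elements. -/
theorem IsNgammaHyperelliptic.card_half_even_gaps {γ : ℕ} {S : Set ℕ}
    (hS : IsNgammaHyperelliptic 2 γ S) {G : Finset ℕ} (hG : ∀ t, t ∈ G ↔ 2 * t ∉ S) :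
    G.card = γ := by
  classical
  obtain ⟨⟨h0, hadd, -⟩, hcard, heven, -, hsucc⟩ := hS
  set P : Finset ℕ := (Finset.Icc 1 (2 * γ)).filter (2 * · ∈ S) with hPdef
  have hP : ∀ y, y ∈ P ↔ y ∈ {t | 2 * t ∈ S} ∧ 0 < y ∧ y ≤ 2 * γ := by
    intro y
    simp only [hPdef, Finset.mem_filter, Finset.mem_Icc, Set.mem_ofPred_eq]
    grind
  have hPcard : P.card = γ := by
    have himg : {s ∈ S | 0 < s ∧ s ≤ 2 * γ * 2} = (P.image (2 * ·) : Finset ℕ) := by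
      ext s
      simp only [Set.mem_ofPred_eq, Finset.coe_image, Set.mem_image, Finset.mem_coe, hP]
      constructor
      · rintro ⟨hs, hpos, hle⟩
        obtain ⟨t, rfl⟩ := heven s hs hpos hle
        exact ⟨t, ⟨hs, by lia, by lia⟩, rfl⟩
      · rintro ⟨t, ⟨hs, hpos, hle⟩, rfl⟩
        exact ⟨hs, by lia, by lia⟩
    rw [himg, Set.ncard_coe_finset,
      Finset.card_image_of_injective _ (mul_right_injective₀ two_ne_zero)] at hcard
    exact hcard
  have hlarge := mem_of_two_mul_lt (T := {t | 2 * t ∈ S}) (γ := γ)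
    (fun a ha b hb => by simpa [mul_add] using hadd _ ha _ hb) hP hPcard
    (by simpa [mul_comm] using hsucc)
  have hGP : G = Finset.Icc 1 (2 * γ) \ P := by
    ext t
    rw [hG, Finset.mem_sdiff, Finset.mem_Icc, hP]
    constructor
    · intro ht
      refine ⟨⟨?_, ?_⟩, fun h => ht h.1⟩
      · rcases Nat.eq_zero_or_pos t with rfl | h
        · exact absurd h0 ht
        · exact h
      · by_contra hlt
        exact ht (hlarge t (by lia))
    · rintro ⟨⟨h1, h2⟩, h⟩ ht
      exact h ⟨ht, h1, h2⟩
  rw [hGP, Finset.card_sdiff_of_subset (fun y hy => (Finset.mem_filter.1 hy).1), hPcard,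
    Nat.card_Icc]
  lia

theorem sum_range_two_mul_add_one (m : ℕ) : ∑ i ∈ Finset.range m, (2 * i + 1) = m ^ 2 := by
  induction m with
  | zero => simp
  | succ m ih => rw [Finset.sum_range_succ, ih]; ring

/-- Torres' weight bounds for (2,γ)-hyperelliptic semigroups. -/
theorem stmt2 (γ g : ℕ) (S : Set ℕ)
    (hS : IsNgammaHyperelliptic 2 γ S) (hg : genus S = g) (hgγ : 2 * γ ≤ g) :
    ((g - 2 * γ).choose 2 : ℤ) ≤ weight S ∧
      weight S ≤ ((g - 2 * γ).choose 2 : ℤ) + 2 * (γ : ℤ) ^ 2 := by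
  classical
  obtain ⟨⟨h0, hadd, hfin⟩, -⟩ := id hS
  have hodd : ∃ m, 2 * m + 1 ∈ S := by
    by_contra! h
    exact Set.infinite_of_injective_forall_mem (f := fun m : ℕ => 2 * m + 1)
      (fun a b hab => by simpa using hab) h hfin
  set m := Nat.find hodd
  have hmS : 2 * m + 1 ∈ S := Nat.find_spec hodd
  have hmin : ∀ i < m, 2 * i + 1 ∉ S := fun i hi => Nat.find_min hodd hi
  have injE : Function.Injective fun t : ℕ => 2 * t := fun a b hab => by simpa using hab
  have injL : Function.Injective fun t : ℕ => 2 * t + 1 := fun a b hab => by simpa using hab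
  have injO : Function.Injective fun t : ℕ => 2 * (m + t) + 1 := fun a b hab => by
    simpa using hab
  obtain ⟨G, hG⟩ : ∃ G : Finset ℕ, ∀ t, t ∈ G ↔ 2 * t ∉ S :=
    ⟨(hfin.preimage injE.injOn).toFinset, by simp⟩
  obtain ⟨A, hA⟩ : ∃ A : Finset ℕ, ∀ t, t ∈ A ↔ 2 * (m + t) + 1 ∉ S :=
    ⟨(hfin.preimage injO.injOn).toFinset, by simp⟩
  have hGγ : G.card = γ := hS.card_half_even_gaps hG
  have hG0 : 0 ∉ G := by simpa [hG] using h0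
  have hAG : A ⊆ G := fun t ht => by
    rw [hA] at ht
    rw [hG]
    intro h
    have := hadd _ hmS _ h
    rw [show 2 * m + 1 + 2 * t = 2 * (m + t) + 1 by ring] at this
    exact ht this
  have hsubA : ∀ x ∈ A, ∀ t ≤ x, t ∉ G → x - t ∈ A := fun x hx t htx ht => by
    rw [hG, not_not] at ht
    rw [hA] at hx ⊢
    intro h
    have := hadd _ h _ ht
    rw [show 2 * (m + (x - t)) + 1 + 2 * t = 2 * (m + x) + 1 by lia] at this
    exact hx this
  have hsubG : ∀ x ∈ G, ∀ t ≤ x, t ∉ G → x - t ∈ G := fun x hx t htx ht => by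
    rw [hG, not_not] at ht
    rw [hG] at hx ⊢
    intro h
    have := hadd _ h _ ht
    rw [show 2 * (x - t) + 2 * t = 2 * x by lia] at this
    exact hx this
  have hgaps : Sᶜ = ((G.image (2 * ·) ∪ ((Finset.range m).image (2 * · + 1) ∪
      A.image (fun t => 2 * (m + t) + 1)) : Finset ℕ) : Set ℕ) := by
    ext s
    simp only [Set.mem_compl_iff, Finset.coe_union, Finset.coe_image, Set.mem_union, Set.mem_image,
      Finset.mem_coe, hG, hA, Finset.mem_range]
    constructor
    · intro hs
      obtain ⟨k, rfl | rfl⟩ := Nat.even_or_odd' s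
      · exact Or.inl ⟨k, hs, rfl⟩
      · rcases lt_or_ge k m with hk | hk
        · exact Or.inr (Or.inl ⟨k, hk, rfl⟩)
        · obtain ⟨t, rfl⟩ := Nat.exists_eq_add_of_le hk
          exact Or.inr (Or.inr ⟨t, hs, rfl⟩)
    · rintro (⟨t, ht, rfl⟩ | ⟨t, ht, rfl⟩ | ⟨t, ht, rfl⟩)
      exacts [ht, hmin t ht, ht]
  have hdisjO : Disjoint ((Finset.range m).image (2 * · + 1)) (A.image (fun t => 2 * (m + t) + 1)) := by
    rw [Finset.disjoint_left]
    intro y hy hy'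
    simp only [Finset.mem_image, Finset.mem_range] at hy hy'
    lia
  have hdisj : Disjoint (G.image (2 * ·)) ((Finset.range m).image (2 * · + 1) ∪
      A.image (fun t => 2 * (m + t) + 1)) := by
    rw [Finset.disjoint_left]
    intro y hy hy'
    simp only [Finset.mem_union, Finset.mem_image, Finset.mem_range] at hy hy'
    lia
  have hgenus : g = γ + (m + A.card) := by
    rw [← hg, genus, hgaps, Set.ncard_coe_finset, Finset.card_union_of_disjoint hdisj,
      Finset.card_union_of_disjoint hdisjO, Finset.card_image_of_injective _ injE,
      Finset.card_image_of_injective _ injL, Finset.card_image_of_injective _ injO, hGγ,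
      Finset.card_range]
  have hsum : ∑ᶠ ℓ ∈ Sᶜ, (ℓ : ℤ) = 2 * ((∑ x ∈ G, x : ℕ) : ℤ) +
      ((m : ℤ) ^ 2 + (2 * ((∑ x ∈ A, x : ℕ) : ℤ) + A.card * (2 * m + 1))) := by
    have hL := sum_range_two_mul_add_one m
    rw [hgaps, finsum_mem_coe_finset, Finset.sum_union hdisj, Finset.sum_union hdisjO,
      Finset.sum_image injE.injOn, Finset.sum_image injL.injOn, Finset.sum_image injO.injOn,
      ← Nat.cast_sum (Finset.range m), hL]
    push_cast
    rw [Finset.mul_sum]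
    congr 2
    rw [Finset.mul_sum, ← nsmul_eq_mul, ← Finset.sum_const, ← Finset.sum_add_distrib]
    exact Finset.sum_congr rfl fun x _ => by ring
  have hGlow := Finset.choose_two_card_add_card_le_sum hG0
  have hGup := Finset.sum_le_of_sub_mem subset_rfl hsubG
  have hAlow := A.choose_two_card_le_sum
  have hAup := Finset.sum_le_of_sub_mem hAG hsubA
  rw [hGγ] at hGlow hGup hAup
  have hcγ := two_mul_choose_two_cast γ
  have hcA := two_mul_choose_two_cast A.card
  have hcg := two_mul_choose_two_cast (g - 2 * γ)
  rw [Nat.cast_sub hgγ] at hcg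
  have hhalf : 2 * ((g : ℤ) * (g + 1) / 2) = g * (g + 1) :=
    Int.two_mul_ediv_two_of_even (Int.even_mul_succ_self g)
  have hw : weight S = ∑ᶠ ℓ ∈ Sᶜ, (ℓ : ℤ) - (g : ℤ) * (g + 1) / 2 := by rw [weight, hg]
  rw [hw, hsum]
  generalize (g : ℤ) * (g + 1) / 2 = q at *
  generalize (g - 2 * γ).choose 2 = c at *
  generalize ∑ x ∈ A, x = sA at *
  generalize ∑ x ∈ G, x = sG at *
  have hgenus' : (g : ℤ) = γ + (m + A.card) := by exact_mod_cast hgenus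
  rw [hgenus'] at hhalf hcg
  zify at hGlow hGup hAlow hAup
  push_cast at hcg
  constructor <;> nlinarith
end

section
/- Every (3,γ)-hyperelliptic numerical semigroup S of genus g with γ ≥ 1 satisfies u_1(S) ≥ g − 3γ + 1 + ⌊(g mod 3)/2⌋; equivalently, χ(S) ≥ 0. -/
/-- u₁(S): the smallest positive element of S not divisible by 3. -/
noncomputable def u1 (S : Set ℕ) : ℕ := sInf {s ∈ S | ¬ 3 ∣ s}

/-- χ(S) = u₁(S) − (g − 3γ + 1 + ⌊(g mod 3)/2⌋), computed in ℤ. -/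
noncomputable def chi (γ g : ℕ) (S : Set ℕ) : ℤ :=
  (u1 S : ℤ) - ((g : ℤ) - 3 * γ + 1 + ((g : ℤ) % 3) / 2)

/-- S_i: the elements of S ∩ {1,…,2g} congruent to i modulo 3. -/
def resSet (g i : ℕ) (S : Set ℕ) : Set ℕ :=
  {s ∈ S | 1 ≤ s ∧ s ≤ 2 * g ∧ s % 3 = i}

/-- The inflection Ĩ_S = Σ_{s ∈ S ∩ {1,…,2g}} s. -/
noncomputable def inflection (g : ℕ) (S : Set ℕ) : ℕ :=
  ∑ᶠ s ∈ {s ∈ S | 1 ≤ s ∧ s ≤ 2 * g}, s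

open Classical in
/-- A subset of ℕ closed under addition with exactly `γ` elements and `γ` gaps in `[1, 2γ]` which
contains `2γ + 1` contains every larger integer. -/
theorem mem_of_two_mul_lt_s3 {T : Set ℕ} {γ : ℕ} (hadd : ∀ a ∈ T, ∀ b ∈ T, a + b ∈ T)
    (hgap : {t ∈ Finset.Icc 1 (2 * γ) | t ∉ T}.card = γ) (hT : 2 * γ + 1 ∈ T)
    (n : ℕ) (hn : 2 * γ < n) : n ∈ T := by
  induction n using Nat.strong_induction_on with
  | _ n ih =>
  by_contra hnT
  have hne : n ≠ 2 * γ + 1 := by rintro rfl; exact hnT hT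
  have hsum := Finset.card_filter_add_card_filter_not (s := Finset.Ico 1 n) (· ∈ T)
  rw [Nat.card_Ico] at hsum
  have hB : {t ∈ Finset.Ico 1 n | t ∉ T}.card = γ := by
    rw [← hgap]
    congr 1
    ext t
    simp only [Finset.mem_filter, Finset.mem_Ico, Finset.mem_Icc]
    constructor
    · rintro ⟨⟨h1, h2⟩, h3⟩
      refine ⟨⟨h1, ?_⟩, h3⟩
      by_contra! h
      exact h3 (ih t h2 h)
    · rintro ⟨⟨h1, h2⟩, h3⟩
      exact ⟨⟨h1, by omega⟩, h3⟩
  have hle : {t ∈ Finset.Ico 1 n | t ∈ T}.card ≤ {t ∈ Finset.Ico 1 n | t ∉ T}.card := by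
    refine Finset.card_le_card_of_injOn (fun t => n - t) ?_ ?_
    · intro t ht
      simp only [Finset.coe_filter, Finset.mem_Ico, Set.mem_ofPred_eq] at ht ⊢
      refine ⟨by omega, fun h => hnT ?_⟩
      have := hadd _ ht.2 _ h
      rwa [Nat.add_sub_cancel' ht.1.2.le] at this
    · intro a ha b hb hab
      simp only [Finset.coe_filter, Finset.mem_Ico, Set.mem_ofPred_eq] at ha hb hab
      omega
  omega

open Classical in
/-- The multiples of `3` contribute exactly `γ` gaps to a `(3, γ)`-hyperelliptic semigroup. -/
theorem IsNgammaHyperelliptic.exists_finset_gaps {γ : ℕ} {S : Set ℕ}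
    (hS : IsNgammaHyperelliptic 3 γ S) :
    ∃ G : Finset ℕ, G.card = γ ∧ ∀ t, 3 * t ∉ S → t ∈ G := by
  obtain ⟨⟨h0, hadd, -⟩, hcard, hdvd, -, hmem⟩ := hS
  set T : Set ℕ := {t | 3 * t ∈ S} with hTdef
  have hin : {t ∈ Finset.Icc 1 (2 * γ) | t ∈ T}.card = γ := by
    rw [← hcard, ← Set.ncard_coe_finset,
      ← Set.ncard_image_of_injective _ (mul_right_injective₀ (three_ne_zero (α := ℕ)))]
    congr 1
    ext s
    simp only [Set.mem_image, Finset.coe_filter, Finset.mem_Icc, Set.mem_ofPred_eq, hTdef]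
    constructor
    · rintro ⟨t, ⟨ht, htS⟩, rfl⟩
      exact ⟨htS, by omega, by omega⟩
    · rintro ⟨hs, hpos, hle⟩
      obtain ⟨t, rfl⟩ := hdvd s hs hpos hle
      exact ⟨t, ⟨by omega, hs⟩, rfl⟩
  have hgap : {t ∈ Finset.Icc 1 (2 * γ) | t ∉ T}.card = γ := by
    have := Finset.card_filter_add_card_filter_not (s := Finset.Icc 1 (2 * γ)) (· ∈ T)
    rw [Nat.card_Icc] at this
    omega
  refine ⟨_, hgap, fun t ht => ?_⟩
  simp only [Finset.mem_filter, Finset.mem_Icc]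
  refine ⟨⟨Nat.pos_of_ne_zero ?_, ?_⟩, ht⟩
  · rintro rfl
    exact ht h0
  · by_contra! h
    refine ht (mem_of_two_mul_lt_s3 (T := T) (fun a ha b hb => ?_) hgap ?_ t h)
    · simpa only [hTdef, Set.mem_ofPred_eq, mul_add] using hadd _ ha _ hb
    · simpa only [hTdef, Set.mem_ofPred_eq, mul_comm] using hmem

/-- If `v` lies in an additively closed set `S`, every gap congruent to `v` modulo `3` is either
below `v` or of the form `v + 3t` with `3t` a gap. -/
theorem gap_mem_of_mod_three_eq {S : Set ℕ} (hadd : ∀ a ∈ S, ∀ b ∈ S, a + b ∈ S)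
    {G : Finset ℕ} (hG : ∀ t, 3 * t ∉ S → t ∈ G) {v n : ℕ} (hv : v ∈ S) (hn : n ∉ S)
    (hmod : n % 3 = v % 3) :
    n ∈ (Finset.range (v / 3)).image (fun i => 3 * i + v % 3) ∪ G.image (fun t => v + 3 * t) := by
  simp only [Finset.mem_union, Finset.mem_image, Finset.mem_range]
  rcases lt_or_ge n v with h | h
  · exact Or.inl ⟨n / 3, by omega, by omega⟩
  · have hnv : v + 3 * ((n - v) / 3) = n := by omega
    exact Or.inr ⟨(n - v) / 3, hG _ fun h' => hn (hnv ▸ hadd _ hv _ h'), hnv⟩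

/-- If `u ∈ S` is prime to `3` and at most `γ` multiples of `3` are gaps, then `S` has fewer than
`3γ + u` gaps. -/
theorem genus_lt_of_mem {S : Set ℕ} (h0 : 0 ∈ S) (hadd : ∀ a ∈ S, ∀ b ∈ S, a + b ∈ S)
    {G : Finset ℕ} (hG : ∀ t, 3 * t ∉ S → t ∈ G) {u : ℕ} (hu : u ∈ S) (hu3 : ¬ 3 ∣ u) :
    genus S < 3 * G.card + u := by
  set A : ℕ → Finset ℕ := fun v =>
    (Finset.range (v / 3)).image (fun i => 3 * i + v % 3) ∪ G.image (fun t => v + 3 * t) with hA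
  have hAcard (v : ℕ) : (A v).card ≤ v / 3 + G.card :=
    (Finset.card_union_le _ _).trans
      (add_le_add (Finset.card_image_le.trans_eq (Finset.card_range _)) Finset.card_image_le)
  have hsub : Sᶜ ⊆ ((A 0 ∪ A u ∪ A (2 * u) : Finset ℕ) : Set ℕ) := by
    intro n hn
    have hmod : n % 3 = 0 % 3 ∨ n % 3 = u % 3 ∨ n % 3 = (2 * u) % 3 := by
      have : u % 3 = 1 ∨ u % 3 = 2 := by omega
      omega
    have h2u : 2 * u ∈ S := two_mul u ▸ hadd u hu u hu
    simp only [Finset.mem_coe, Finset.mem_union (s := A 0 ∪ A u), Finset.mem_union (s := A 0)]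
    rcases hmod with h | h | h
    · exact Or.inl (Or.inl (gap_mem_of_mod_three_eq hadd hG h0 hn h))
    · exact Or.inl (Or.inr (gap_mem_of_mod_three_eq hadd hG hu hn h))
    · exact Or.inr (gap_mem_of_mod_three_eq hadd hG h2u hn h)
  have hle : genus S ≤ (A 0 ∪ A u ∪ A (2 * u)).card := by
    rw [genus, ← Set.ncard_coe_finset]
    exact Set.ncard_le_ncard hsub (Finset.finite_toSet _)
  have h1 := Finset.card_union_le (A 0 ∪ A u) (A (2 * u))
  have h2 := Finset.card_union_le (A 0) (A u)
  have h3 := hAcard 0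
  have h4 := hAcard u
  have h5 := hAcard (2 * u)
  omega

/-- The infimum defining `u1` is attained. -/
theorem IsNumericalSemigroup.u1_mem {S : Set ℕ} (hS : IsNumericalSemigroup S) :
    u1 S ∈ S ∧ ¬ 3 ∣ u1 S := by
  refine Nat.sInf_mem (s := {s ∈ S | ¬ 3 ∣ s}) ?_
  obtain ⟨b, hb⟩ := hS.2.2.bddAbove
  refine ⟨3 * b + 1, ?_, by omega⟩
  by_contra h
  have := hb h
  omega

/-- u₁(S) ≥ g − 3γ + 1 + ⌊(g mod 3)/2⌋, i.e. χ(S) ≥ 0. -/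
theorem stmt3 (γ g : ℕ) (hγ : 1 ≤ γ) (S : Set ℕ)
    (hS : IsNgammaHyperelliptic 3 γ S) (hg : genus S = g) :
    (g : ℤ) - 3 * γ + 1 + ((g : ℤ) % 3) / 2 ≤ (u1 S : ℤ) ∧ 0 ≤ chi γ g S := by
  obtain ⟨G, hGcard, hG⟩ := hS.exists_finset_gaps
  obtain ⟨hu, hu3⟩ := hS.1.u1_mem
  have hlt := genus_lt_of_mem hS.1.1 hS.1.2.1 hG hu hu3
  rw [hg, hGcard] at hlt
  have hg3 : g % 3 = 0 ∨ g % 3 = 1 ∨ g % 3 = 2 := by omega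
  have hbound : (g : ℤ) - 3 * γ + 1 + ((g : ℤ) % 3) / 2 ≤ (u1 S : ℤ) := by
    rcases hg3 with h | h | h <;> omega
  exact ⟨hbound, sub_nonneg.2 hbound⟩
end

section
/- For every γ ≥ 1 there exists g₀ such that for all g ≥ g₀ the following holds: if T is a (3,γ)-hyperelliptic numerical semigroup of genus g whose weight W_T is maximal among all (3,γ)-hyperelliptic numerical semigroups of genus g, then χ(T) < 6γ. -/
/-- The genus and the sum of the gaps, split according to the residues modulo 3. -/
lemma genus_and_gapSum_eq {S : Set ℕ} {D₀ D₁ D₂ : Finset ℕ}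
    (h₀ : ∀ n, n ∈ D₀ ↔ 3 * n ∉ S) (h₁ : ∀ n, n ∈ D₁ ↔ 3 * n + 1 ∉ S)
    (h₂ : ∀ n, n ∈ D₂ ↔ 3 * n + 2 ∉ S) :
    genus S = D₀.card + D₁.card + D₂.card ∧
    (∑ᶠ ℓ ∈ Sᶜ, (ℓ : ℤ)) = 3 * (∑ n ∈ D₀, (n : ℤ)) + (3 * (∑ n ∈ D₁, (n : ℤ)) + D₁.card)
      + (3 * (∑ n ∈ D₂, (n : ℤ)) + 2 * D₂.card) := by
  have inj₀ : Function.Injective (fun n : ℕ => 3 * n) := fun a b h => by simp at h; omega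
  have inj₁ : Function.Injective (fun n : ℕ => 3 * n + 1) := fun a b h => by simp at h; omega
  have inj₂ : Function.Injective (fun n : ℕ => 3 * n + 2) := fun a b h => by simp at h; omega
  have hS : Sᶜ = ((D₀.image (fun n => 3 * n) ∪ D₁.image (fun n => 3 * n + 1)) ∪
      D₂.image (fun n => 3 * n + 2) : Finset ℕ) := by
    ext s
    simp only [Set.mem_compl_iff, Finset.coe_union, Finset.coe_image, Set.mem_union,
      Set.mem_image, Finset.mem_coe]
    constructor
    · intro hs
      have hr : s % 3 = 0 ∨ s % 3 = 1 ∨ s % 3 = 2 := by omega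
      rcases hr with hr | hr | hr
      · have e : 3 * (s / 3) = s := by omega
        exact Or.inl (Or.inl ⟨s / 3, (h₀ _).2 (by rwa [e]), e⟩)
      · have e : 3 * (s / 3) + 1 = s := by omega
        exact Or.inl (Or.inr ⟨s / 3, (h₁ _).2 (by rwa [e]), e⟩)
      · have e : 3 * (s / 3) + 2 = s := by omega
        exact Or.inr ⟨s / 3, (h₂ _).2 (by rwa [e]), e⟩
    · rintro ((⟨n, hn, rfl⟩ | ⟨n, hn, rfl⟩) | ⟨n, hn, rfl⟩)
      · exact (h₀ n).1 hn
      · exact (h₁ n).1 hn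
      · exact (h₂ n).1 hn
  have d₁ : Disjoint (D₀.image (fun n => 3 * n)) (D₁.image (fun n => 3 * n + 1)) := by
    simp only [Finset.disjoint_left, Finset.mem_image]
    rintro _ ⟨a, _, rfl⟩ ⟨b, _, h⟩
    omega
  have d₂ : Disjoint (D₀.image (fun n => 3 * n) ∪ D₁.image (fun n => 3 * n + 1))
      (D₂.image (fun n => 3 * n + 2)) := by
    simp only [Finset.disjoint_left, Finset.mem_image, Finset.mem_union]
    rintro _ (⟨a, _, rfl⟩ | ⟨a, _, rfl⟩) ⟨b, _, h⟩ <;> omega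
  constructor
  · rw [genus, hS, Set.ncard_coe_finset, Finset.card_union_of_disjoint d₂,
      Finset.card_union_of_disjoint d₁, Finset.card_image_of_injective _ inj₀,
      Finset.card_image_of_injective _ inj₁, Finset.card_image_of_injective _ inj₂]
  · rw [hS, finsum_mem_coe_finset, Finset.sum_union d₂, Finset.sum_union d₁,
      Finset.sum_image inj₀.injOn, Finset.sum_image inj₁.injOn, Finset.sum_image inj₂.injOn]
    push_cast
    simp only [Finset.sum_add_distrib, ← Finset.mul_sum, Finset.sum_const, nsmul_eq_mul]
    ring

/-- A (3,γ)-hyperelliptic semigroup contains every multiple of 3 from `6γ` on. -/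
lemma IsNgammaHyperelliptic.three_mul_mem {γ : ℕ} {T : Set ℕ}
    (hT : IsNgammaHyperelliptic 3 γ T) :
    (∀ n, 2 * γ ≤ n → 3 * n ∈ T) ∧
    ∀ D : Finset ℕ, (∀ n, n ∈ D ↔ 3 * n ∉ T) → D.card = γ := by
  classical
  obtain ⟨⟨hzero, hadd, hfin⟩, hcard, hdvd, hmem, hmem'⟩ := hT
  set F := (Finset.Icc 1 (2 * γ)).filter (fun n => 3 * n ∈ T) with hF
  set Q := (Finset.Icc 1 (2 * γ)).filter (fun n => ¬ 3 * n ∈ T) with hQ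
  have hFcard : F.card = γ := by
    have inj : Function.Injective (fun n : ℕ => 3 * n) := fun a b h => by simp at h; omega
    rw [← hcard, ← Finset.card_image_of_injective F inj, ← Set.ncard_coe_finset]
    congr 1
    ext s
    simp only [hF, Finset.coe_image, Set.mem_image, Finset.mem_coe, Finset.mem_filter,
      Finset.mem_Icc, Set.mem_ofPred_eq]
    constructor
    · rintro ⟨n, ⟨h, hn⟩, rfl⟩
      exact ⟨hn, by omega, by omega⟩
    · rintro ⟨hs, h1, h2⟩
      obtain ⟨n, rfl⟩ := hdvd s hs h1 h2
      exact ⟨n, ⟨by omega, hs⟩, rfl⟩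
  have hQcard : Q.card = γ := by
    have h := Finset.card_filter_add_card_filter_not (s := Finset.Icc 1 (2 * γ))
      (fun n => 3 * n ∈ T)
    rw [← hF, ← hQ, hFcard, Nat.card_Icc] at h
    omega
  have hlarge : ∀ n, 2 * γ ≤ n → 3 * n ∈ T := by
    intro n
    induction n using Nat.strong_induction_on with
    | _ n ih =>
      intro hn
      by_contra hnot
      have hn1 : n ≠ 2 * γ := by
        rintro rfl
        exact hnot (by convert hmem using 1; ring)
      have hn2 : n ≠ 2 * γ + 1 := by
        rintro rfl
        exact hnot (by convert hmem' using 1; ring)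
      have hle : (insert (2 * γ + 1) F).card ≤ Q.card := by
        refine Finset.card_le_card_of_injOn (fun a => n - a) ?_ ?_
        · intro a ha
          have ha' : 1 ≤ a ∧ a ≤ 2 * γ + 1 ∧ 3 * a ∈ T := by
            simp only [hF, Finset.coe_insert, Set.mem_insert_iff, Finset.mem_coe,
              Finset.mem_filter, Finset.mem_Icc] at ha
            rcases ha with rfl | ha
            · exact ⟨by omega, le_rfl, by convert hmem' using 1; ring⟩
            · exact ⟨by omega, by omega, ha.2⟩
          have hg : ¬ 3 * (n - a) ∈ T := by
            intro h
            refine hnot ?_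
            have := hadd _ h _ ha'.2.2
            rwa [show 3 * (n - a) + 3 * a = 3 * n by omega] at this
          have hlt : n - a < 2 * γ := by
            by_contra h
            exact hg (ih (n - a) (by omega) (by omega))
          simp only [hQ, Finset.mem_coe, Finset.mem_filter, Finset.mem_Icc]
          exact ⟨by omega, hg⟩
        · intro a ha b hb hab
          simp only [hF, Finset.coe_insert, Set.mem_insert_iff, Finset.mem_coe,
            Finset.mem_filter, Finset.mem_Icc] at ha hb hab
          omega
      rw [Finset.card_insert_of_notMem (by simp [hF])] at hle
      omega
  refine ⟨hlarge, fun D hD => ?_⟩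
  rw [← hQcard]
  congr 1
  ext n
  simp only [hD, hQ, Finset.mem_filter, Finset.mem_Icc]
  constructor
  · intro h
    refine ⟨⟨?_, ?_⟩, h⟩
    · rcases Nat.eq_zero_or_pos n with rfl | h0
      · exact absurd hzero h
      · exact h0
    · by_contra h'
      exact h (hlarge n (by omega))
  · exact fun h => h.2

lemma two_mul_sum_range_cast (b : ℕ) : 2 * (∑ n ∈ Finset.range b, (n : ℤ)) = b * (b - 1) := by
  induction b with
  | zero => simp
  | succ k ih => rw [Finset.sum_range_succ, mul_add, ih]; push_cast; ring

/-- A finite set consisting of an initial segment and of elements of a window of length `c`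
has sum close to the minimal one. -/
lemma two_mul_sum_le_of_window {D : Finset ℕ} {b c : ℕ} (hlow : ∀ n < b, n ∈ D)
    (hhigh : ∀ n, b + c ≤ n → n ∉ D) :
    2 * (∑ n ∈ D, (n : ℤ)) ≤ D.card * (D.card - 1) + 2 * c ^ 2 := by
  have hlow' : D.filter (· < b) = Finset.range b := by
    ext n
    simp only [Finset.mem_filter, Finset.mem_range]
    exact ⟨fun h => h.2, fun h => ⟨hlow n h, h⟩⟩
  have hsum := Finset.sum_filter_add_sum_filter_not D (· < b) (fun n => (n : ℤ))
  have hcard := Finset.card_filter_add_card_filter_not (s := D) (· < b)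
  rw [hlow'] at hsum hcard
  rw [Finset.card_range] at hcard
  set H := D.filter (fun n => ¬ n < b) with hH
  have hsub : ∀ n ∈ H, b ≤ n ∧ n < b + c := by
    intro n hn
    rw [hH, Finset.mem_filter] at hn
    refine ⟨by omega, ?_⟩
    by_contra h
    exact hhigh n (by omega) hn.1
  have hHc : H.card ≤ c := by
    calc H.card ≤ (Finset.Ico b (b + c)).card :=
          Finset.card_le_card fun n hn => Finset.mem_Ico.2 (hsub n hn)
      _ = c := by simp
  have hHs : ∑ n ∈ H, (n : ℤ) ≤ H.card * (b + c : ℤ) := by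
    rw [← nsmul_eq_mul]
    refine Finset.sum_le_card_nsmul _ _ _ fun n hn => ?_
    have := (hsub n hn).2
    exact_mod_cast this.le
  have hr := two_mul_sum_range_cast b
  rw [← hcard, ← hsum]
  push_cast
  have h1 : (0 : ℤ) ≤ H.card := by positivity
  have h2 : (H.card : ℤ) ≤ c := by exact_mod_cast hHc
  have h3 : (0 : ℤ) ≤ H.card * (H.card - 1) := by
    rcases Nat.eq_zero_or_pos H.card with h | h
    · simp [h]
    · have : (1 : ℤ) ≤ H.card := by exact_mod_cast h
      exact mul_nonneg h1 (by linarith)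
  nlinarith [mul_nonneg (sub_nonneg.2 h2) (by positivity : (0 : ℤ) ≤ c)]

/-- The gaps of a (3,γ)-hyperelliptic semigroup in a fixed residue class have nearly
minimal sum. -/
lemma IsNgammaHyperelliptic.two_mul_sum_le {γ i : ℕ} {T : Set ℕ}
    (hT : IsNgammaHyperelliptic 3 γ T) {D : Finset ℕ} (hD : ∀ n, n ∈ D ↔ 3 * n + i ∉ T) :
    2 * (∑ n ∈ D, (n : ℤ)) ≤ D.card * (D.card - 1) + 2 * (2 * γ : ℕ) ^ 2 := by
  classical
  have hex : ∃ n, n ∉ D := Infinite.exists_notMem_finset D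
  refine two_mul_sum_le_of_window (b := Nat.find hex)
    (fun n hn => not_not.1 (Nat.find_min hex hn)) fun n hn h => ?_
  have hb : 3 * Nat.find hex + i ∈ T := by
    have := Nat.find_spec hex
    rwa [hD, not_not] at this
  have := hT.1.2.1 _ hb _ (hT.three_mul_mem.1 (n - Nat.find hex) (by omega))
  rw [show 3 * Nat.find hex + i + 3 * (n - Nat.find hex) = 3 * n + i by omega] at this
  exact (hD n).1 h this

/-- The semigroup whose residue classes modulo 3 are `{0} ∪ [γ + 1, ∞)`, `[a, ∞)` and
`[b, ∞)`. -/
def truncatedSemigroup (γ a b : ℕ) : Set ℕ :=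
  {s | (s % 3 = 0 ∧ (s = 0 ∨ 3 * γ + 3 ≤ s)) ∨ (s % 3 = 1 ∧ 3 * a + 1 ≤ s) ∨
    (s % 3 = 2 ∧ 3 * b + 2 ≤ s)}

lemma mem_truncatedSemigroup {γ a b s : ℕ} : s ∈ truncatedSemigroup γ a b ↔
    (s % 3 = 0 ∧ (s = 0 ∨ 3 * γ + 3 ≤ s)) ∨ (s % 3 = 1 ∧ 3 * a + 1 ≤ s) ∨
    (s % 3 = 2 ∧ 3 * b + 2 ≤ s) := Iff.rfl

lemma isNgammaHyperelliptic_truncatedSemigroup {γ a b : ℕ} (hγ : 1 ≤ γ) (ha : 2 * γ ≤ a)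
    (hb : 2 * γ ≤ b) (hab : b ≤ 2 * a) (hba : a ≤ 2 * b + 1) :
    IsNgammaHyperelliptic 3 γ (truncatedSemigroup γ a b) := by
  refine ⟨⟨?_, ?_, ?_⟩, ?_, ?_, ?_, ?_⟩
  · simp [mem_truncatedSemigroup]
  · intro x hx y hy
    rw [mem_truncatedSemigroup] at *
    omega
  · refine (Set.finite_lt_nat (3 * (γ + a + b) + 3)).subset fun s hs => ?_
    rw [Set.mem_compl_iff, mem_truncatedSemigroup] at hs
    simp only [Set.mem_ofPred_eq]
    omega
  · have inj : Function.Injective (fun n : ℕ => 3 * n) := fun a b h => by simp at h; omega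
    have : {s ∈ truncatedSemigroup γ a b | 0 < s ∧ s ≤ 2 * γ * 3} =
        ((Finset.Icc (γ + 1) (2 * γ)).image (fun n => 3 * n) : Finset ℕ) := by
      ext s
      simp only [Set.mem_ofPred_eq, mem_truncatedSemigroup, Finset.coe_image, Set.mem_image,
        Finset.coe_Icc, Set.mem_Icc]
      constructor
      · intro h
        exact ⟨s / 3, by omega, by omega⟩
      · rintro ⟨n, hn, rfl⟩
        omega
    rw [this, Set.ncard_coe_finset, Finset.card_image_of_injective _ inj, Nat.card_Icc]
    omega
  · intro s hs h0 h1
    rw [mem_truncatedSemigroup] at hs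
    omega
  · rw [mem_truncatedSemigroup]
    omega
  · rw [mem_truncatedSemigroup]
    omega

lemma genus_and_gapSum_truncatedSemigroup (γ a b : ℕ) :
    genus (truncatedSemigroup γ a b) = γ + a + b ∧
    (3 * (a * (a - 1)) + 2 * a + 3 * (b * (b - 1)) + 4 * b : ℤ) ≤
      2 * ∑ᶠ ℓ ∈ (truncatedSemigroup γ a b)ᶜ, (ℓ : ℤ) := by
  obtain ⟨h1, h2⟩ := genus_and_gapSum_eq (S := truncatedSemigroup γ a b)
    (D₀ := Finset.Icc 1 γ) (D₁ := Finset.range a) (D₂ := Finset.range b)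
    (fun n => by rw [mem_truncatedSemigroup, Finset.mem_Icc]; omega)
    (fun n => by rw [mem_truncatedSemigroup, Finset.mem_range]; omega)
    (fun n => by rw [mem_truncatedSemigroup, Finset.mem_range]; omega)
  constructor
  · simpa using h1
  · rw [h2, Finset.card_range, Finset.card_range]
    have h0 : (0 : ℤ) ≤ ∑ n ∈ Finset.Icc 1 γ, (n : ℤ) :=
      Finset.sum_nonneg fun n _ => by positivity
    linarith [two_mul_sum_range_cast a, two_mul_sum_range_cast b]

/-- Upper bound for the sum of the gaps of a (3,γ)-hyperelliptic semigroup all of whose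
elements prime to 3 are large. -/
lemma IsNgammaHyperelliptic.exists_gapSum_le {γ m : ℕ} {T : Set ℕ}
    (hT : IsNgammaHyperelliptic 3 γ T) (hm : ∀ s ∈ T, ¬ 3 ∣ s → 3 * m ≤ s) :
    ∃ a b : ℕ, m ≤ a ∧ m ≤ b ∧ genus T = γ + a + b ∧
      2 * (∑ᶠ ℓ ∈ Tᶜ, (ℓ : ℤ)) ≤
        3 * (a * (a - 1)) + 2 * a + 3 * (b * (b - 1)) + 4 * b + 60 * γ ^ 2 := by
  classical
  have hfin := hT.1.2.2
  have hD : ∀ i, ∃ D : Finset ℕ, ∀ n, n ∈ D ↔ 3 * n + i ∉ T := by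
    intro i
    have inj : Function.Injective (fun n : ℕ => 3 * n + i) := fun a b h => by simp at h; omega
    refine ⟨(hfin.preimage (f := fun n : ℕ => 3 * n + i) inj.injOn).toFinset, fun n => ?_⟩
    simp
  obtain ⟨D₀, h₀⟩ := hD 0
  obtain ⟨D₁, h₁⟩ := hD 1
  obtain ⟨D₂, h₂⟩ := hD 2
  simp only [add_zero] at h₀
  obtain ⟨hg, hs⟩ := genus_and_gapSum_eq h₀ h₁ h₂
  have hc₀ := hT.three_mul_mem.2 D₀ h₀
  have hlow : ∀ i, i = 1 ∨ i = 2 → ∀ D : Finset ℕ, (∀ n, n ∈ D ↔ 3 * n + i ∉ T) →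
      m ≤ D.card := by
    intro i hi D hD
    rw [← Finset.card_range m]
    refine Finset.card_le_card fun n hn => (hD n).2 fun h => ?_
    have := hm _ h (by omega)
    rw [Finset.mem_range] at hn
    omega
  refine ⟨D₁.card, D₂.card, hlow 1 (.inl rfl) D₁ h₁, hlow 2 (.inr rfl) D₂ h₂, ?_, ?_⟩
  · rw [hg, hc₀]
  · have hs₀ : ∑ n ∈ D₀, (n : ℤ) ≤ γ * (2 * γ : ℤ) := by
      nth_rewrite 1 [← hc₀]
      rw [← nsmul_eq_mul]
      refine Finset.sum_le_card_nsmul _ _ _ fun n hn => ?_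
      by_contra h
      push Not at h
      exact (h₀ n).1 hn (hT.three_mul_mem.1 n (by exact_mod_cast h.le))
    have hs₁ := hT.two_mul_sum_le h₁
    have hs₂ := hT.two_mul_sum_le h₂
    push_cast at hs₁ hs₂
    rw [hs]
    nlinarith

/-- for g ≫ γ, any maximal-weight (3,γ)-hyperelliptic semigroup
of genus g satisfies χ < 6γ. -/
theorem stmt5 (γ : ℕ) (hγ : 1 ≤ γ) :
    ∃ g₀ : ℕ, ∀ g ≥ g₀, ∀ T : Set ℕ,
      IsNgammaHyperelliptic 3 γ T → genus T = g →
      (∀ S : Set ℕ, IsNgammaHyperelliptic 3 γ S → genus S = g →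
        weight S ≤ weight T) →
      chi γ g T < 6 * γ := by
  refine ⟨100 * γ ^ 2 + 100 * γ + 100, fun g hg T hT hgT hmax => ?_⟩
  by_contra! hchi
  obtain ⟨m, hm⟩ : ∃ m, m = (g + 1) / 3 + γ := ⟨_, rfl⟩
  have hu : ∀ s ∈ T, ¬ 3 ∣ s → 3 * m ≤ s := by
    intro s hs h3
    have hle : u1 T ≤ s := Nat.sInf_le ⟨hs, h3⟩
    rw [chi] at hchi
    omega
  obtain ⟨a, b, ha, hb, hab, hsum⟩ := hT.exists_gapSum_le hu
  obtain ⟨e, rfl⟩ : ∃ e, m = e + 1 := ⟨m - 1, by omega⟩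
  obtain ⟨x, rfl⟩ := Nat.exists_eq_add_of_le ha
  obtain ⟨y, rfl⟩ := Nat.exists_eq_add_of_le hb
  have hS := isNgammaHyperelliptic_truncatedSemigroup (γ := γ) (a := e)
    (b := e + x + y + 2) hγ (by omega) (by omega) (by omega) (by omega)
  obtain ⟨hgS, hsumS⟩ := genus_and_gapSum_truncatedSemigroup γ e (e + x + y + 2)
  have hw := hmax _ hS (by omega)
  have hgenus : genus (truncatedSemigroup γ e (e + x + y + 2)) = genus T := by omega
  rw [weight, weight, hgenus] at hw
  have hxy : (10 * γ ^ 2 : ℤ) < x + y := by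
    have : 10 * γ ^ 2 < x + y := by omega
    exact_mod_cast this
  push_cast at hsum hsumS
  have hxy' : (0 : ℤ) ≤ x * y := by positivity
  nlinarith
end

section
/- For every γ ≥ 1 there exists g₀ such that for all g ≥ g₀ the following holds: let S and T be (3,γ)-hyperelliptic numerical semigroups of genus g with S_0 = T_0 and u_1(S) = u_1(T) = u_1, and suppose that χ(S) = χ(T) < 6γ and that #T_{(u_1 mod 3)} > #S_{(u_1 mod 3)}. Then W_T > W_S. -/
lemma IsNumericalSemigroup.mul_mem {S : Set ℕ} (hS : IsNumericalSemigroup S) {a : ℕ}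
    (ha : a ∈ S) (k : ℕ) : k * a ∈ S := by
  induction k with
  | zero => simpa using hS.1
  | succ k ih => rw [Nat.succ_mul]; exact hS.2.1 _ ih _ ha

/-- Every sufficiently large multiple of 3 lies in a (3,γ)-hyperelliptic semigroup. -/
lemma IsNgammaHyperelliptic.mem_of_mod_three {γ : ℕ} {S : Set ℕ} (hγ : 1 ≤ γ)
    (hS : IsNgammaHyperelliptic 3 γ S) {x : ℕ} (hx : x % 3 = 0) (hle : 12 * γ ^ 2 ≤ x) :
    x ∈ S := by
  obtain ⟨n, rfl⟩ := Nat.dvd_of_mod_eq_zero hx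
  have hpos : 0 < 2 * γ := by omega
  have hr := Nat.mod_lt n hpos
  have hq : 2 * γ ≤ n / (2 * γ) := by
    rw [Nat.le_div_iff_mul_le hpos]
    nlinarith
  have hn := Nat.div_add_mod n (2 * γ)
  generalize n / (2 * γ) = q at hq hn
  generalize n % (2 * γ) = r at hr hn
  obtain ⟨t, rfl⟩ := Nat.exists_eq_add_of_le (hr.le.trans hq)
  have h := hS.1.2.1 _ (hS.1.mul_mem hS.2.2.2.1 t) _ (hS.1.mul_mem hS.2.2.2.2 r)
  convert h using 1
  rw [← hn]
  ring

lemma IsNumericalSemigroup.exists_mem_mod_three {S : Set ℕ} (hS : IsNumericalSemigroup S)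
    {r : ℕ} (hr : r < 3) : ∃ v ∈ S, v % 3 = r := by
  obtain ⟨B, hB⟩ := hS.2.2.bddAbove
  refine ⟨3 * (B + 1) + r, ?_, by omega⟩
  by_contra h
  have := hB h
  omega

/-- Each residue class modulo 3 has a least element in the semigroup. -/
lemma IsNumericalSemigroup.exists_least_mod_three {S : Set ℕ} (hS : IsNumericalSemigroup S)
    {r : ℕ} (hr : r < 3) :
    ∃ v ∈ S, v % 3 = r ∧ ∀ x, x % 3 = r → x < v → x ∉ S := by
  have hne : {s ∈ S | s % 3 = r}.Nonempty := by
    obtain ⟨v, hv, h⟩ := hS.exists_mem_mod_three hr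
    exact ⟨v, hv, h⟩
  have hmem := Nat.sInf_mem hne
  exact ⟨_, hmem.1, hmem.2, fun x hx hlt hxS => Nat.notMem_of_lt_sInf hlt ⟨hxS, hx⟩⟩

lemma IsNumericalSemigroup.u1_spec {S : Set ℕ} (hS : IsNumericalSemigroup S) :
    u1 S ∈ S ∧ u1 S % 3 ≠ 0 ∧ ∀ x, x % 3 = u1 S % 3 → x < u1 S → x ∉ S := by
  have hne : {s ∈ S | ¬ 3 ∣ s}.Nonempty := by
    obtain ⟨v, hv, h⟩ := hS.exists_mem_mod_three (r := 1) (by omega)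
    exact ⟨v, hv, by omega⟩
  have hmem : u1 S ∈ {s ∈ S | ¬ 3 ∣ s} := Nat.sInf_mem hne
  have h3 : u1 S % 3 ≠ 0 := fun h => hmem.2 (Nat.dvd_of_mod_eq_zero h)
  exact ⟨hmem.1, h3, fun x hx hlt hxS => Nat.notMem_of_lt_sInf hlt ⟨hxS, by omega⟩⟩

lemma IsNumericalSemigroup.mem_of_add_le {S : Set ℕ} (hS : IsNumericalSemigroup S) {F v x : ℕ}
    (hF : ∀ y, y % 3 = 0 → F ≤ y → y ∈ S) (hv : v ∈ S) (hx : x % 3 = v % 3)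
    (hle : v + F ≤ x) : x ∈ S := by
  have h := hS.2.1 _ hv _ (hF (x - v) (by omega) (by omega))
  rwa [Nat.add_sub_cancel' (by omega)] at h

lemma three_mul_card_le {A : Finset ℕ} {r n : ℕ} (h : ∀ x ∈ A, x % 3 = r ∧ x < n) :
    3 * A.card ≤ n + 2 := by
  have hcard : A.card ≤ (Finset.range ((n + 2) / 3)).card := by
    refine Finset.card_le_card_of_injOn (· / 3) (fun x hx => ?_) (fun x hx y hy hxy => ?_)
    · have := h x hx
      simp only [Finset.coe_range, Set.mem_Iio]
      omega
    · have := h x hx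
      have := h y hy
      simp only at hxy
      omega
  rw [Finset.card_range] at hcard
  omega

lemma le_three_mul_card {A : Finset ℕ} {r n : ℕ} (hr : r < 3)
    (h : ∀ x, x % 3 = r → x < n → x ∈ A) : n ≤ 3 * A.card + 2 := by
  have hcard : (Finset.range (n / 3)).card ≤ A.card := by
    refine Finset.card_le_card_of_injOn (fun k => 3 * k + r) (fun k hk => ?_)
      (fun x _ y _ hxy => ?_)
    · simp only [Finset.coe_range, Set.mem_Iio] at hk
      exact h (3 * k + r) (by omega) (by omega)
    · simp only at hxy
      omega
  rw [Finset.card_range] at hcard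
  omega

/-- If `X` and `Y` agree below `lo` and `Y` lies below `lo + c`, the difference of their sums is
controlled by the difference of their cardinalities. -/
lemma sum_sub_sum_ge {X Y : Finset ℕ} {lo c : ℕ} (hX : ∀ x ∈ X \ Y, lo ≤ x)
    (hY : ∀ y ∈ Y \ X, lo ≤ y ∧ y < lo + c) :
    ((X.card : ℤ) - Y.card) * lo - c ^ 2 ≤ ∑ x ∈ X, (x : ℤ) - ∑ y ∈ Y, (y : ℤ) := by
  have hsub : ∀ Z : Finset ℕ, ∑ z ∈ Z, ((z : ℤ) - lo) = ∑ z ∈ Z, (z : ℤ) - Z.card * lo := by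
    intro Z
    simp [Finset.sum_sub_distrib]
  have hdiff := Finset.sum_sdiff_sub_sum_sdiff (s₁ := X) (s₂ := Y) (f := fun z : ℕ => (z : ℤ) - lo)
  rw [hsub X, hsub Y] at hdiff
  have hnonneg : 0 ≤ ∑ x ∈ X \ Y, ((x : ℤ) - lo) :=
    Finset.sum_nonneg fun x hx => by have := hX x hx; omega
  have hle : ∑ y ∈ Y \ X, ((y : ℤ) - lo) ≤ (Y \ X).card * (c : ℤ) := by
    rw [← nsmul_eq_mul]
    exact Finset.sum_le_card_nsmul _ _ _ fun y hy => by have := hY y hy; omega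
  have hcard : (Y \ X).card ≤ c := by
    have h : Y \ X ⊆ Finset.Ico lo (lo + c) := fun y hy => Finset.mem_Ico.2 (hY y hy)
    simpa using Finset.card_le_card h
  have hmul : ((Y \ X).card : ℤ) * c ≤ c * c := by
    exact_mod_cast Nat.mul_le_mul_right c hcard
  linarith [sq (c : ℤ)]

lemma sum_eq_sum_mod_three {M : Type*} [AddCommMonoid M] (G : Finset ℕ) (f : ℕ → M) {i j : ℕ}
    (hij : i = 1 ∧ j = 2 ∨ i = 2 ∧ j = 1) :
    ∑ x ∈ G, f x = ∑ x ∈ G with x % 3 = 0, f x + ∑ x ∈ G with x % 3 = i, f x +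
      ∑ x ∈ G with x % 3 = j, f x := by
  rw [← Finset.sum_filter_add_sum_filter_not G (fun x => x % 3 = 0), add_assoc,
    ← Finset.sum_filter_add_sum_filter_not (G.filter fun x => ¬ x % 3 = 0) (fun x => x % 3 = i),
    Finset.filter_filter, Finset.filter_filter]
  congr 3 <;> ext x <;> simp only [Finset.mem_filter] <;> grind

lemma ncard_resSet_add_card {S : Set ℕ} {g i : ℕ} {A : Finset ℕ}
    (hA : ∀ x, x ∈ A ↔ x ∉ S ∧ x % 3 = i) (hbound : ∀ x ∈ A, 1 ≤ x ∧ x ≤ 2 * g) :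
    (resSet g i S).ncard + A.card = ((Finset.Icc 1 (2 * g)).filter (· % 3 = i)).card := by
  classical
  have hres : resSet g i S =
      ↑((((Finset.Icc 1 (2 * g)).filter (· % 3 = i)) \ A : Finset ℕ)) := by
    ext x
    simp only [resSet, Set.mem_ofPred_eq, Finset.coe_sdiff, Finset.coe_filter, Finset.mem_Icc,
      Set.mem_sdiff, Finset.mem_coe, hA]
    tauto
  rw [hres, Set.ncard_coe_finset]
  refine Finset.card_sdiff_add_card_eq_card fun x hx => ?_
  exact Finset.mem_filter.2 ⟨Finset.mem_Icc.2 (hbound x hx), ((hA x).1 hx).2⟩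

/-- with S₀ = T₀, u₁(S) = u₁(T), χ < 6γ and
#T_{(u₁ mod 3)} > #S_{(u₁ mod 3)}, we have W_T > W_S. -/
theorem stmt6 (γ : ℕ) (hγ : 1 ≤ γ) :
    ∃ g₀ : ℕ, ∀ g ≥ g₀, ∀ S T : Set ℕ,
      IsNgammaHyperelliptic 3 γ S → IsNgammaHyperelliptic 3 γ T →
      genus S = g → genus T = g →
      resSet g 0 S = resSet g 0 T →
      u1 S = u1 T →
      chi γ g S < 6 * γ →
      (resSet g (u1 S % 3) S).ncard < (resSet g (u1 T % 3) T).ncard →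
      weight S < weight T := by
  obtain ⟨F, hFdef⟩ : ∃ F, F = 12 * γ ^ 2 := ⟨_, rfl⟩
  refine ⟨3 * F + 6 * γ + 20 + F ^ 2 + (4 * F + 10) ^ 2, ?_⟩
  intro g hg S T hS hT hgS hgT h0 hu hchi hcard
  have hFS : ∀ y, y % 3 = 0 → F ≤ y → y ∈ S := fun y hy hle =>
    hS.mem_of_mod_three hγ hy (hFdef ▸ hle)
  have hFT : ∀ y, y % 3 = 0 → F ≤ y → y ∈ T := fun y hy hle =>
    hT.mem_of_mod_three hγ hy (hFdef ▸ hle)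
  obtain ⟨huS, hu3, hltS⟩ := hS.1.u1_spec
  obtain ⟨huT, -, hltT⟩ := hT.1.u1_spec
  rw [← hu] at huT hltT hcard
  unfold chi at hchi
  generalize u1 S = u at *
  clear hu
  have hub : u < g + 3 * γ + 2 := by omega
  obtain ⟨i, hi⟩ : ∃ i, i = u % 3 := ⟨_, rfl⟩
  obtain ⟨j, hij⟩ : ∃ j, i = 1 ∧ j = 2 ∨ i = 2 ∧ j = 1 := ⟨3 - i, by omega⟩
  rw [← hi] at hltS hltT hcard
  obtain ⟨v, hvS, hvj, hltvS⟩ := hS.1.exists_least_mod_three (r := j) (by omega)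
  obtain ⟨w, hwT, hwj, hltwT⟩ := hT.1.exists_least_mod_three (r := j) (by omega)
  have hfullS : ∀ x, x % 3 = i → u + F ≤ x → x ∈ S := fun x hx hle =>
    hS.1.mem_of_add_le hFS huS (hx.trans hi) hle
  have hfullT : ∀ x, x % 3 = i → u + F ≤ x → x ∈ T := fun x hx hle =>
    hT.1.mem_of_add_le hFT huT (hx.trans hi) hle
  have hfullvS : ∀ x, x % 3 = j → v + F ≤ x → x ∈ S := fun x hx hle =>
    hS.1.mem_of_add_le hFS hvS (hx.trans hvj.symm) hle
  have hfullwT : ∀ x, x % 3 = j → w + F ≤ x → x ∈ T := fun x hx hle =>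
    hT.1.mem_of_add_le hFT hwT (hx.trans hwj.symm) hle
  obtain ⟨GS, hGS⟩ := hS.1.2.2.exists_finset_coe
  obtain ⟨GT, hGT⟩ := hT.1.2.2.exists_finset_coe
  have hmemS : ∀ x, x ∈ GS ↔ x ∉ S := fun x => by rw [← Finset.mem_coe, hGS]; rfl
  have hmemT : ∀ x, x ∈ GT ↔ x ∉ T := fun x => by rw [← Finset.mem_coe, hGT]; rfl
  have hcS : GS.card = g := by rw [← hgS, genus, ← hGS, Set.ncard_coe_finset]
  have hcT : GT.card = g := by rw [← hgT, genus, ← hGT, Set.ncard_coe_finset]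
  have hzero : GS.filter (· % 3 = 0) = GT.filter (· % 3 = 0) := by
    ext x
    simp only [Finset.mem_filter, hmemS, hmemT, and_congr_left_iff, not_iff_not]
    intro hx
    by_cases hxF : F ≤ x
    · exact iff_of_true (hFS x hx hxF) (hFT x hx hxF)
    rcases Nat.eq_zero_or_pos x with rfl | hpos
    · exact iff_of_true hS.1.1 hT.1.1
    have h := Set.ext_iff.1 h0 x
    simp only [resSet, Set.mem_ofPred_eq] at h
    have h1 : 1 ≤ x ∧ x ≤ 2 * g ∧ x % 3 = 0 := ⟨hpos, by omega, hx⟩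
    simpa only [h1, and_true, true_and] using h
  have hsplitS := sum_eq_sum_mod_three GS (fun _ => 1) hij
  have hsplitT := sum_eq_sum_mod_three GT (fun _ => 1) hij
  simp only [← Finset.card_eq_sum_ones, hcS, hcT, ← hzero] at hsplitS hsplitT
  have hsumS := sum_eq_sum_mod_three GS (fun x => (x : ℤ)) hij
  have hsumT := sum_eq_sum_mod_three GT (fun x => (x : ℤ)) hij
  rw [← hzero] at hsumT
  have hz := three_mul_card_le (A := GS.filter (· % 3 = 0)) (r := 0) (n := F) (by
    intro x hx
    rw [Finset.mem_filter, hmemS] at hx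
    exact ⟨hx.2, not_le.1 fun h => hx.1 (hFS x hx.2 h)⟩)
  have hAS : ∀ x, x ∈ GS.filter (· % 3 = i) ↔ x ∉ S ∧ x % 3 = i := by simp [hmemS]
  have hAT : ∀ x, x ∈ GT.filter (· % 3 = i) ↔ x ∉ T ∧ x % 3 = i := by simp [hmemT]
  have hBS : ∀ x, x ∈ GS.filter (· % 3 = j) ↔ x ∉ S ∧ x % 3 = j := by simp [hmemS]
  have hBT : ∀ x, x ∈ GT.filter (· % 3 = j) ↔ x ∉ T ∧ x % 3 = j := by simp [hmemT]
  generalize GS.filter (· % 3 = i) = AS at *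
  generalize GT.filter (· % 3 = i) = AT at *
  generalize GS.filter (· % 3 = j) = BS at *
  generalize GT.filter (· % 3 = j) = BT at *
  have hASlt : ∀ x ∈ AS, x % 3 = i ∧ x < u + F := fun x hx =>
    have h := (hAS x).1 hx
    ⟨h.2, not_le.1 fun hle => h.1 (hfullS x h.2 hle)⟩
  have hATlt : ∀ x ∈ AT, x % 3 = i ∧ x < u + F := fun x hx =>
    have h := (hAT x).1 hx
    ⟨h.2, not_le.1 fun hle => h.1 (hfullT x h.2 hle)⟩
  have hBSlt : ∀ x ∈ BS, x % 3 = j ∧ x < v + F := fun x hx =>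
    have h := (hBS x).1 hx
    ⟨h.2, not_le.1 fun hle => h.1 (hfullvS x h.2 hle)⟩
  have hBTlt : ∀ x ∈ BT, x % 3 = j ∧ x < w + F := fun x hx =>
    have h := (hBT x).1 hx
    ⟨h.2, not_le.1 fun hle => h.1 (hfullwT x h.2 hle)⟩
  have hASmem : ∀ x, x % 3 = i → x < u → x ∈ AS := fun x hx hlt =>
    (hAS x).2 ⟨hltS x hx hlt, hx⟩
  have hATmem : ∀ x, x % 3 = i → x < u → x ∈ AT := fun x hx hlt =>
    (hAT x).2 ⟨hltT x hx hlt, hx⟩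
  have hBSmem : ∀ x, x % 3 = j → x < v → x ∈ BS := fun x hx hlt =>
    (hBS x).2 ⟨hltvS x hx hlt, hx⟩
  have hBTmem : ∀ x, x % 3 = j → x < w → x ∈ BT := fun x hx hlt =>
    (hBT x).2 ⟨hltwT x hx hlt, hx⟩
  have hresS := ncard_resSet_add_card (g := g) hAS fun x hx => by
    have := hASlt x hx
    omega
  have hresT := ncard_resSet_add_card (g := g) hAT fun x hx => by
    have := hATlt x hx
    omega
  have hAcard : AT.card < AS.card := by omega
  have hAS1 := three_mul_card_le hASlt
  have hAS2 := le_three_mul_card (by omega) hASmem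
  have hAT1 := three_mul_card_le hATlt
  have hAT2 := le_three_mul_card (by omega) hATmem
  have hBS1 := three_mul_card_le hBSlt
  have hBS2 := le_three_mul_card (by omega) hBSmem
  have hBT1 := three_mul_card_le hBTlt
  have hBT2 := le_three_mul_card (by omega) hBTmem
  have hsumA := sum_sub_sum_ge (X := AT) (Y := AS) (lo := u) (c := F)
    (fun x hx => by
      rw [Finset.mem_sdiff] at hx
      exact not_lt.1 fun h => hx.2 (hASmem x (hATlt x hx.1).1 h))
    (fun x hx => by
      rw [Finset.mem_sdiff] at hx
      exact ⟨not_lt.1 fun h => hx.2 (hATmem x (hASlt x hx.1).1 h), (hASlt x hx.1).2⟩)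
  have hsumB := sum_sub_sum_ge (X := BT) (Y := BS) (lo := min v w) (c := 4 * F + 10)
    (fun x hx => by
      rw [Finset.mem_sdiff] at hx
      exact not_lt.1 fun h => hx.2 (hBSmem x (hBTlt x hx.1).1 (lt_min_iff.1 h).1))
    (fun x hx => by
      rw [Finset.mem_sdiff] at hx
      refine ⟨not_lt.1 fun h => hx.2 (hBTmem x (hBSlt x hx.1).1 (lt_min_iff.1 h).2), ?_⟩
      have := (hBSlt x hx.1).2
      omega)
  have hgap : u + F ^ 2 + (4 * F + 10) ^ 2 < min v w := by omega
  have hBcard : (BT.card : ℤ) - BS.card = AS.card - AT.card := by omega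
  rw [hBcard] at hsumB
  have hd : (1 : ℤ) ≤ AS.card - AT.card := by omega
  generalize min v w = V at *
  have hgap' : (u : ℤ) + F ^ 2 + (4 * F + 10) ^ 2 < V := by exact_mod_cast hgap
  push_cast at hsumB
  have hprod : (V : ℤ) - u ≤ (AS.card - AT.card) * (V - u) :=
    le_mul_of_one_le_left (by linarith [sq_nonneg (F : ℤ), sq_nonneg (4 * (F : ℤ) + 10)]) hd
  unfold weight
  rw [hgS, hgT, ← hGS, ← hGT, finsum_mem_coe_finset, finsum_mem_coe_finset, hsumS, hsumT]
  refine sub_lt_sub_right ?_ _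
  linarith
end

section
/- For every γ ≥ 1 there exists g₀ such that for all g ≥ g₀ the following holds: let S and T be (3,γ)-hyperelliptic numerical semigroups of genus g with S_0 = T_0; write u_1 = u_1(S) and u_1' = u_1(T), and assume χ(S) < 6γ. Assume moreover that #S_{(u_1 mod 3)} ≥ #S'_{(u_1 mod 3)} for every (3,γ)-hyperelliptic numerical semigroup S' of genus g with S'_0 = S_0 and u_1(S') = u_1, and likewise that #T_{(u_1' mod 3)} ≥ #T'_{(u_1' mod 3)} for every (3,γ)-hyperelliptic numerical semigroup T' of genus g with T'_0 = S_0 and u_1(T') = u_1'. If S_{(u_1 mod 3)} is strictly contained in T_{(u_1' mod 3)}, then Ĩ_T < Ĩ_S. -/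
/-- Two consecutive multiples `3a`, `3(a+1)` in `S` force all large multiples of `3` into `S`. -/
theorem IsNumericalSemigroup.three_mul_mem {S : Set ℕ} (hS : IsNumericalSemigroup S) {a : ℕ}
    (ha : 0 < a) (h₁ : a * 3 ∈ S) (h₂ : (a + 1) * 3 ∈ S) {n : ℕ} (hn : a * a ≤ n) :
    3 * n ∈ S := by
  have mul_mem : ∀ s ∈ S, ∀ k : ℕ, k * s ∈ S := by
    intro s hs k
    induction k with
    | zero => simpa using hS.1
    | succ k ih => rw [Nat.succ_mul]; exact hS.2.1 _ ih _ hs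
  have hr : n % a < a := Nat.mod_lt _ ha
  have hq : a ≤ n / a := (Nat.le_div_iff_mul_le ha).2 hn
  obtain ⟨t, ht⟩ := Nat.exists_eq_add_of_le (hr.le.trans hq)
  have hdiv := Nat.div_add_mod n a
  have key : 3 * n = t * (a * 3) + (n % a) * ((a + 1) * 3) := by
    rw [ht] at hdiv
    calc 3 * n = 3 * (a * (n % a + t) + n % a) := by rw [hdiv]
      _ = _ := by ring
  rw [key]
  exact hS.2.1 _ (mul_mem _ h₁ t) _ (mul_mem _ h₂ _)

/-- Every gap of a numerical semigroup is smaller than twice the genus. -/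
theorem IsNumericalSemigroup.lt_two_mul_genus {S : Set ℕ} (hS : IsNumericalSemigroup S) {x : ℕ}
    (hx : x ∉ S) : x < 2 * genus S := by
  classical
  have hcard : genus S = hS.2.2.toFinset.card := Set.ncard_eq_toFinset_card _ hS.2.2
  have hsub : Finset.range (x + 1) ⊆ hS.2.2.toFinset ∪ hS.2.2.toFinset.image (x - ·) := by
    intro a ha
    have hax : a ≤ x := by simpa [Nat.lt_succ_iff] using ha
    by_cases haS : a ∈ S
    · refine Finset.mem_union_right _ (Finset.mem_image.2 ⟨x - a, ?_, by omega⟩)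
      rw [Set.Finite.mem_toFinset]
      intro hxa
      apply hx
      have := hS.2.1 _ haS _ hxa
      rwa [Nat.add_sub_cancel' hax] at this
    · exact Finset.mem_union_left _ (by simpa using haS)
  have h := (Finset.card_le_card hsub).trans (Finset.card_union_le _ _)
  have h' : (hS.2.2.toFinset.image (x - ·)).card ≤ hS.2.2.toFinset.card := Finset.card_image_le
  rw [Finset.card_range] at h
  omega

open Classical in
theorem IsNumericalSemigroup.sum_indicator {S : Set ℕ} (hS : IsNumericalSemigroup S) :
    ∑ x ∈ Finset.range (2 * genus S + 1), (if x ∈ S then (1 : ℤ) else 0) = genus S + 1 := by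
  have hcard : genus S = hS.2.2.toFinset.card := Set.ncard_eq_toFinset_card _ hS.2.2
  have hgap : (Finset.range (2 * genus S + 1)).filter (fun x => x ∉ S) = hS.2.2.toFinset := by
    ext x
    simp only [Finset.mem_filter, Finset.mem_range, Set.Finite.mem_toFinset, Set.mem_compl_iff]
    exact ⟨fun h => h.2, fun h => ⟨by have := hS.lt_two_mul_genus h; omega, h⟩⟩
  have h := Finset.card_filter_add_card_filter_not (s := Finset.range (2 * genus S + 1))
    (fun x => x ∈ S)
  rw [hgap, ← hcard, Finset.card_range] at h
  rw [Finset.sum_boole]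
  have : ((Finset.range (2 * genus S + 1)).filter (fun x => x ∈ S)).card = genus S + 1 := by omega
  rw [this]
  push_cast
  rfl

open Classical in
theorem inflection_eq_sum (g : ℕ) (S : Set ℕ) :
    (inflection g S : ℤ) = ∑ x ∈ Finset.range (2 * g + 1), if x ∈ S then (x : ℤ) else 0 := by
  have hset : {s ∈ S | 1 ≤ s ∧ s ≤ 2 * g} =
      (((Finset.range (2 * g + 1)).filter (fun x => x ∈ S ∧ 1 ≤ x) : Finset ℕ) : Set ℕ) := by
    ext x
    simp only [Set.mem_ofPred_eq, Finset.coe_filter, Finset.mem_range]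
    constructor
    · rintro ⟨h, h1, h2⟩; exact ⟨by omega, h, h1⟩
    · rintro ⟨h, h1, h2⟩; exact ⟨h1, h2, by omega⟩
  unfold inflection
  rw [hset, finsum_mem_coe_finset, Finset.sum_filter]
  push_cast
  refine Finset.sum_congr rfl fun x _ => ?_
  rcases Nat.eq_zero_or_pos x with rfl | hx
  · simp
  · simp [Nat.one_le_iff_ne_zero.2 hx.ne']

/-- If `S` contains, in each residue class modulo `3`, everything from `3k`, `u + 3k`, `v + 3k` on,
then its genus is bounded. -/
theorem IsNumericalSemigroup.three_mul_genus_le {S : Set ℕ} (hS : IsNumericalSemigroup S)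
    {u v k : ℕ} (hu : u % 3 ≠ 0) (hv : v % 3 ≠ 0) (huv : u % 3 ≠ v % 3)
    (h₀ : ∀ n, k ≤ n → 3 * n ∈ S) (hu' : u ∈ S) (hv' : v ∈ S) :
    3 * genus S ≤ u + v + 9 * k + 6 := by
  classical
  have hcard : genus S = hS.2.2.toFinset.card := Set.ncard_eq_toFinset_card _ hS.2.2
  have hsub : hS.2.2.toFinset ⊆ (Finset.range k).image (3 * ·) ∪
      ((Finset.range (u / 3 + k)).image (fun i => 3 * i + u % 3) ∪
        (Finset.range (v / 3 + k)).image (fun i => 3 * i + v % 3)) := by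
    intro x hx
    rw [Set.Finite.mem_toFinset, Set.mem_compl_iff] at hx
    have shift : ∀ w ∈ S, x % 3 = w % 3 → x / 3 < w / 3 + k := by
      intro w hw hxw
      by_contra! hlt
      apply hx
      have := hS.2.1 _ hw _ (h₀ (x / 3 - w / 3) (by omega))
      rwa [show w + 3 * (x / 3 - w / 3) = x by omega] at this
    simp only [Finset.mem_union, Finset.mem_image, Finset.mem_range]
    have hcases : x % 3 = 0 ∨ x % 3 = u % 3 ∨ x % 3 = v % 3 := by omega
    rcases hcases with h | h | h
    · left
      have := shift 0 hS.1 (by omega)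
      exact ⟨x / 3, by omega, by omega⟩
    · exact Or.inr (Or.inl ⟨x / 3, shift u hu' h, by omega⟩)
    · exact Or.inr (Or.inr ⟨x / 3, shift v hv' h, by omega⟩)
  have h := (Finset.card_le_card hsub).trans
    ((Finset.card_union_le _ _).trans (Nat.add_le_add_left (Finset.card_union_le _ _) _))
  have i₁ := Finset.card_image_le (s := Finset.range k) (f := (3 * ·))
  have i₂ := Finset.card_image_le (s := Finset.range (u / 3 + k)) (f := fun i => 3 * i + u % 3)
  have i₃ := Finset.card_image_le (s := Finset.range (v / 3 + k)) (f := fun i => 3 * i + v % 3)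
  rw [Finset.card_range] at i₁ i₂ i₃
  omega

open Classical in
/-- Comparison of inflections for semigroups of the same genus: if, away from the window
`[v, v + m)`, exchanging `T` for `S` only moves elements below `v` in `T` to elements above it
in `S`, and some element of `T \ S` lies far below `v`, then `S` has the larger inflection. -/
theorem inflection_lt_of_exchange {S T : Set ℕ} {g v m x₀ : ℕ} (hS : IsNumericalSemigroup S)
    (hT : IsNumericalSemigroup T) (hgS : genus S = g) (hgT : genus T = g)
    (hlow : ∀ x ≤ 2 * g, x < v → x ∈ S → x ∈ T)
    (hhigh : ∀ x ≤ 2 * g, v + m ≤ x → x ∈ T → x ∈ S)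
    (hx₀ : x₀ ≤ 2 * g) (hx₀T : x₀ ∈ T) (hx₀S : x₀ ∉ S) (hlt : x₀ + m * m < v) :
    inflection g T < inflection g S := by
  have hdiff : (inflection g S : ℤ) - inflection g T = ∑ x ∈ Finset.range (2 * g + 1),
      ((if x ∈ S then (1 : ℤ) else 0) - if x ∈ T then 1 else 0) * ((x : ℤ) - v) := by
    have cS := hS.sum_indicator
    have cT := hT.sum_indicator
    rw [hgS] at cS
    rw [hgT] at cT
    simp only [mul_sub, Finset.sum_sub_distrib]
    rw [← Finset.sum_mul, Finset.sum_sub_distrib, cS, cT]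
    simp only [sub_mul, Finset.sum_sub_distrib, inflection_eq_sum, ite_mul, one_mul, zero_mul]
    ring
  have hbound : ∑ x ∈ Finset.range (2 * g + 1), ((if x = x₀ then (v : ℤ) - x₀ else 0) -
      if x ∈ Finset.Ico v (v + m) then (m : ℤ) else 0) ≤
      (inflection g S : ℤ) - inflection g T := by
    rw [hdiff]
    refine Finset.sum_le_sum fun x hx => ?_
    have hxg : x ≤ 2 * g := by simpa [Nat.lt_succ_iff] using hx
    have h₁ := hlow x hxg
    have h₂ := hhigh x hxg
    simp only [Finset.mem_Ico]
    by_cases hxx : x = x₀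
    · subst hxx
      have : ¬ (v ≤ x ∧ x < v + m) := by omega
      simp [hx₀T, hx₀S, this]
    · by_cases hxS : x ∈ S <;> by_cases hxT : x ∈ T <;>
        by_cases hw : v ≤ x ∧ x < v + m <;> simp [hxx, hxS, hxT, hw] <;> grind
  have hsum : ∑ x ∈ Finset.range (2 * g + 1), ((if x = x₀ then (v : ℤ) - x₀ else 0) -
      if x ∈ Finset.Ico v (v + m) then (m : ℤ) else 0) ≥ v - x₀ - m * m := by
    rw [Finset.sum_sub_distrib, Finset.sum_ite_eq' (Finset.range (2 * g + 1)) x₀,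
      if_pos (Finset.mem_range.2 (by omega)), Finset.sum_ite_mem, Finset.sum_const, nsmul_eq_mul]
    have hc : (Finset.range (2 * g + 1) ∩ Finset.Ico v (v + m)).card ≤ m :=
      (Finset.card_le_card Finset.inter_subset_right).trans (by simp)
    have hc' : ((Finset.range (2 * g + 1) ∩ Finset.Ico v (v + m)).card : ℤ) * m ≤ m * m :=
      mul_le_mul_of_nonneg_right (by exact_mod_cast hc) (by positivity)
    linarith
  have : ((x₀ + m * m : ℕ) : ℤ) < v := by exact_mod_cast hlt
  push_cast at this
  zify
  linarith

/-- if S_{(u₁ mod 3)} ⊊ T_{(u₁' mod 3)} for semigroups with the same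
residue-0 part whose residue sets at u₁ are of maximal size for their respective
values of u₁, and χ(S) < 6γ, then Ĩ_T < Ĩ_S. -/
theorem stmt7 (γ : ℕ) (hγ : 1 ≤ γ) :
    ∃ g₀ : ℕ, ∀ g ≥ g₀, ∀ S T : Set ℕ,
      IsNgammaHyperelliptic 3 γ S → IsNgammaHyperelliptic 3 γ T →
      genus S = g → genus T = g →
      resSet g 0 S = resSet g 0 T →
      chi γ g S < 6 * γ →
      (∀ S' : Set ℕ, IsNgammaHyperelliptic 3 γ S' → genus S' = g →
        resSet g 0 S' = resSet g 0 S → u1 S' = u1 S →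
        (resSet g (u1 S % 3) S').ncard ≤ (resSet g (u1 S % 3) S).ncard) →
      (∀ T' : Set ℕ, IsNgammaHyperelliptic 3 γ T' → genus T' = g →
        resSet g 0 T' = resSet g 0 S → u1 T' = u1 T →
        (resSet g (u1 T % 3) T').ncard ≤ (resSet g (u1 T % 3) T).ncard) →
      resSet g (u1 S % 3) S ⊂ resSet g (u1 T % 3) T →
      inflection g T < inflection g S := by
  refine ⟨9 * (2 * γ * (2 * γ)) * (2 * γ * (2 * γ)) + 12 * (2 * γ * (2 * γ)) + 6 * γ + 20, ?_⟩
  intro g hg S T hS hT hgS hgT h0 hchi _ _ hss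
  set k := 2 * γ * (2 * γ) with hk
  have hmul : ∀ n, k ≤ n → 3 * n ∈ S := fun n hn =>
    hS.1.three_mul_mem (by omega) hS.2.2.2.1 hS.2.2.2.2 hn
  have hne : {s ∈ S | ¬ 3 ∣ s}.Nonempty :=
    ⟨3 * k + 3 * g + 1, by
      by_contra hmem
      have := hS.1.lt_two_mul_genus (x := 3 * k + 3 * g + 1) fun h => hmem ⟨h, by omega⟩
      omega⟩
  obtain ⟨huS, hu3⟩ : u1 S ∈ {s ∈ S | ¬ 3 ∣ s} := Nat.sInf_mem hne
  set u := u1 S with hu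
  have hule : u ≤ g + 3 * γ + 1 := by
    unfold chi at hchi
    omega
  have hvne : {s ∈ S | s % 3 ≠ 0 ∧ s % 3 ≠ u % 3}.Nonempty :=
    ⟨u + u, hS.1.2.1 _ huS _ huS, by omega, by omega⟩
  obtain ⟨hvS, hv0, hvu⟩ := Nat.sInf_mem hvne
  have hvmin : ∀ x ∈ S, x % 3 ≠ 0 → x % 3 ≠ u % 3 →
      sInf {s ∈ S | s % 3 ≠ 0 ∧ s % 3 ≠ u % 3} ≤ x := fun x hx h h' => Nat.sInf_le ⟨hx, h, h'⟩
  set v := sInf {s ∈ S | s % 3 ≠ 0 ∧ s % 3 ≠ u % 3}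
  clear_value v u k
  have hcount := hS.1.three_mul_genus_le (by omega) hv0 (Ne.symm hvu) hmul huS hvS
  rw [hgS] at hcount
  have hshift : ∀ w ∈ S, ∀ x, x % 3 = w % 3 → w + 3 * k ≤ x → x ∈ S := by
    intro w hw x hxw hle
    have := hS.1.2.1 _ hw _ (hmul ((x - w) / 3) (by omega))
    rwa [show w + 3 * ((x - w) / 3) = x by omega] at this
  have hres : u % 3 = u1 T % 3 :=
    (hss.1 (show u ∈ resSet g (u % 3) S from ⟨huS, by omega, by omega, rfl⟩)).2.2.2
  rw [← hres] at hss
  obtain ⟨x₀, ⟨hx₀T, hx₀1, hx₀g, hx₀u⟩, hx₀S⟩ := Set.exists_of_ssubset hss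
  replace hx₀S : x₀ ∉ S := fun h => hx₀S ⟨h, hx₀1, hx₀g, hx₀u⟩
  have hx₀lt : x₀ < u + 3 * k := by
    by_contra! h
    exact hx₀S (hshift u huS x₀ hx₀u h)
  have hzero : ∀ x ≤ 2 * g, x % 3 = 0 → (x ∈ S ↔ x ∈ T) := by
    intro x hxg hx
    rcases Nat.eq_zero_or_pos x with rfl | hpos
    · exact iff_of_true hS.1.1 hT.1.1
    · have := Set.ext_iff.1 h0 x
      simpa [resSet, hxg, hx, Nat.one_le_iff_ne_zero.2 hpos.ne', hpos.ne'] using this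
  have hkk : 3 * k * (3 * k) = 9 * k * k := by ring
  have huv : u + 3 * k + 3 * k * (3 * k) < v := by
    rw [hkk]
    omega
  have hthird : ∀ x, x % 3 ≠ 0 → x % 3 ≠ u % 3 → x % 3 = v % 3 := by
    clear * - hu3 hv0 hvu
    omega
  refine inflection_lt_of_exchange (v := v) (m := 3 * k) (x₀ := x₀) hS.1 hT.1 hgS hgT
    ?_ ?_ hx₀g hx₀T hx₀S (by omega)
  · intro x hxg hxv hxS
    by_cases hx3 : x % 3 = 0
    · exact (hzero x hxg hx3).1 hxS
    · by_cases hxu : x % 3 = u % 3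
      · exact (hss.1 (show x ∈ resSet g (u % 3) S from ⟨hxS, by omega, hxg, hxu⟩)).1
      · exact absurd (hvmin x hxS hx3 hxu) (by omega)
  · intro x hxg hxv hxT
    by_cases hx3 : x % 3 = 0
    · exact (hzero x hxg hx3).2 hxT
    · by_cases hxu : x % 3 = u % 3
      · exact hshift u huS x hxu (by omega)
      · exact hshift v hvS x (hthird x hx3 hxu) hxv
end

section
/- For every γ ≥ 0 there exists g₀ such that for all g ≥ g₀ the following holds: if T is a (3,γ)-hyperelliptic numerical semigroup of genus g with u_1 = u_1(T) such that T_{(u_1 mod 3)} = {u_1 + 3k : k ∈ ℕ} ∩ {1,…,2g}, then u_1 ≥ g − γ + 1; moreover, if (g − γ) mod 3 = 2, then u_1 ≥ g − γ + 2. -/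
open Classical in
/-- A set of naturals closed under addition that has `γ` elements in `[1, 2γ]` and contains
`2γ + 1` contains every integer above `2γ`. -/
theorem mem_of_two_mul_lt_s8 {H : Set ℕ} (hadd : ∀ a ∈ H, ∀ b ∈ H, a + b ∈ H) {γ : ℕ}
    (hcard : ((Finset.Icc 1 (2 * γ)).filter (· ∈ H)).card = γ) (hsucc : 2 * γ + 1 ∈ H)
    (m : ℕ) (hm : 2 * γ < m) : m ∈ H := by
  induction m using Nat.strong_induction_on with
  | _ m ih =>
    by_contra hmH
    have hne : m ≠ 2 * γ + 1 := fun h => hmH (h ▸ hsucc)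
    set F := (Finset.Icc 1 (m - 1)).filter (· ∈ H) with hF
    have hlower : γ + (m - 1 - 2 * γ) ≤ F.card := by
      have hdisj : Disjoint ((Finset.Icc 1 (2 * γ)).filter (· ∈ H))
          (Finset.Icc (2 * γ + 1) (m - 1)) := by
        rw [Finset.disjoint_left]
        intro x hx hx'
        simp only [Finset.mem_filter, Finset.mem_Icc] at hx hx'
        omega
      calc γ + (m - 1 - 2 * γ)
          = (((Finset.Icc 1 (2 * γ)).filter (· ∈ H)) ∪
              Finset.Icc (2 * γ + 1) (m - 1)).card := by
            rw [Finset.card_union_of_disjoint hdisj, hcard, Nat.card_Icc]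
            omega
        _ ≤ F.card := by
            refine Finset.card_le_card fun x hx => ?_
            simp only [hF, Finset.mem_union, Finset.mem_filter, Finset.mem_Icc] at hx ⊢
            rcases hx with ⟨hx, hxH⟩ | hx
            · exact ⟨by omega, hxH⟩
            · exact ⟨by omega, ih x (by omega) (by omega)⟩
    have hupper : F.card + F.card ≤ m - 1 := by
      have hinj : (F.image (m - ·)).card = F.card := by
        refine Finset.card_image_of_injOn fun x hx y hy hxy => ?_
        simp only [hF, Finset.coe_filter, Finset.mem_Icc, Set.mem_ofPred_eq] at hx hy hxy
        omega
      have hdisj : Disjoint F (F.image (m - ·)) := by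
        rw [Finset.disjoint_left]
        intro x hx hx'
        obtain ⟨y, hy, rfl⟩ := Finset.mem_image.1 hx'
        simp only [hF, Finset.mem_filter, Finset.mem_Icc] at hx hy
        have := hadd _ hx.2 _ hy.2
        rw [Nat.sub_add_cancel (by omega)] at this
        exact hmH this
      calc F.card + F.card = (F ∪ F.image (m - ·)).card := by
            rw [Finset.card_union_of_disjoint hdisj, hinj]
        _ ≤ (Finset.Icc 1 (m - 1)).card := by
            refine Finset.card_le_card fun x hx => ?_
            simp only [hF, Finset.mem_union, Finset.mem_image, Finset.mem_filter,
              Finset.mem_Icc] at hx ⊢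
            rcases hx with hx | ⟨y, hy, rfl⟩ <;> omega
        _ = m - 1 := by simp
    omega

open Classical in
theorem IsNgammaHyperelliptic.card_filter_three_mul_mem {γ : ℕ} {T : Set ℕ}
    (hT : IsNgammaHyperelliptic 3 γ T) :
    ((Finset.Icc 1 (2 * γ)).filter (3 * · ∈ T)).card = γ := by
  obtain ⟨-, hcard, hdvd, -, -⟩ := hT
  have himage : {s ∈ T | 0 < s ∧ s ≤ 2 * γ * 3} =
      (((Finset.Icc 1 (2 * γ)).filter (3 * · ∈ T)).image (3 * ·) : Finset ℕ) := by
    ext s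
    simp only [Set.mem_ofPred_eq, Finset.coe_image, Set.mem_image, Finset.mem_coe,
      Finset.mem_filter, Finset.mem_Icc]
    constructor
    · rintro ⟨hs, hpos, hle⟩
      obtain ⟨k, rfl⟩ := hdvd s hs hpos hle
      exact ⟨k, ⟨by omega, hs⟩, rfl⟩
    · rintro ⟨k, ⟨hk, hkT⟩, rfl⟩
      exact ⟨hkT, by omega, by omega⟩
  rwa [himage, Set.ncard_coe_finset,
    Finset.card_image_of_injective _ (mul_right_injective₀ (by norm_num))] at hcard

theorem IsNgammaHyperelliptic.three_mul_mem_s8 {γ : ℕ} {T : Set ℕ}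
    (hT : IsNgammaHyperelliptic 3 γ T) {k : ℕ} (hk : 2 * γ ≤ k) : 3 * k ∈ T := by
  classical
  rcases hk.eq_or_lt with rfl | hk
  · have := hT.2.2.2.1
    rwa [mul_comm] at this
  · refine mem_of_two_mul_lt_s8 (H := {k | 3 * k ∈ T}) (fun a ha b hb => ?_) ?_ ?_ k hk
    · have := hT.1.2.1 _ ha _ hb
      rwa [← mul_add] at this
    · exact hT.card_filter_three_mul_mem
    · have := hT.2.2.2.2
      rwa [mul_comm] at this

/-- If `T` contains `u + 3ℕ` for some `u` prime to `3`, then its genus is at most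
`γ + ⌊u/3⌋ + ⌊2u/3⌋ = γ + u - 1`. -/
theorem IsNgammaHyperelliptic.genus_lt {γ u : ℕ} {T : Set ℕ}
    (hT : IsNgammaHyperelliptic 3 γ T) (hu : ¬ 3 ∣ u) (hclass : ∀ k, u + 3 * k ∈ T) :
    genus T < γ + u := by
  classical
  set A := ((Finset.Icc 1 (2 * γ)).filter (¬ 3 * · ∈ T)).image (3 * ·)
  set B := (Finset.range (u / 3)).image (fun i => 3 * i + u % 3)
  set C := (Finset.range (2 * u / 3)).image (fun i => 3 * i + 2 * u % 3)
  have hA : A.card ≤ γ := by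
    refine Finset.card_image_le.trans ?_
    have h := Finset.card_filter_add_card_filter_not (s := Finset.Icc 1 (2 * γ)) (3 * · ∈ T)
    rw [hT.card_filter_three_mul_mem, Nat.card_Icc] at h
    omega
  have hB : B.card ≤ u / 3 := Finset.card_image_le.trans (Finset.card_range _).le
  have hC : C.card ≤ 2 * u / 3 := Finset.card_image_le.trans (Finset.card_range _).le
  have hsub : Tᶜ ⊆ ((A ∪ B ∪ C : Finset ℕ) : Set ℕ) := by
    intro s hs
    simp only [A, B, C, Finset.coe_union, Set.mem_union, Finset.mem_coe, Finset.mem_image,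
      Finset.mem_filter, Finset.mem_Icc, Finset.mem_range]
    have hcases : s % 3 = 0 ∨ s % 3 = u % 3 ∨ s % 3 = 2 * u % 3 := by
      have hu' : u % 3 = 1 ∨ u % 3 = 2 := by omega
      rcases hu' with hu' | hu' <;> omega
    rcases hcases with h | h | h
    · obtain ⟨k, rfl⟩ := Nat.dvd_of_mod_eq_zero h
      refine Or.inl (Or.inl ⟨k, ⟨⟨?_, ?_⟩, hs⟩, rfl⟩)
      · rcases Nat.eq_zero_or_pos k with rfl | hk
        · exact absurd hT.1.1 hs
        · exact hk
      · by_contra hk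
        exact hs (hT.three_mul_mem_s8 (by omega))
    · refine Or.inl (Or.inr ⟨s / 3, ?_, by omega⟩)
      by_contra hk
      refine hs ?_
      have := hclass (s / 3 - u / 3)
      rwa [show u + 3 * (s / 3 - u / 3) = s by omega] at this
    · refine Or.inr ⟨s / 3, ?_, by omega⟩
      by_contra hk
      refine hs ?_
      have := hT.1.2.1 _ (hclass 0) _ (hclass (s / 3 - 2 * u / 3))
      rwa [show u + 3 * 0 + (u + 3 * (s / 3 - 2 * u / 3)) = s by omega] at this
  have hle : genus T ≤ (A ∪ B ∪ C).card := by
    rw [← Set.ncard_coe_finset]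
    exact Set.ncard_le_ncard hsub (Finset.finite_toSet _)
  have := Finset.card_union_le (A ∪ B) C
  have := Finset.card_union_le A B
  omega

/-- if T_{(u₁ mod 3)} = (u₁ + 3ℕ) ∩ [1,2g], then u₁ ≥ g − γ + 1,
and u₁ ≥ g − γ + 2 when (g−γ) mod 3 = 2. -/
theorem stmt8 (γ : ℕ) :
    ∃ g₀ : ℕ, ∀ g ≥ g₀, ∀ T : Set ℕ,
      IsNgammaHyperelliptic 3 γ T → genus T = g →
      resSet g (u1 T % 3) T =
        {s : ℕ | (∃ k : ℕ, s = u1 T + 3 * k) ∧ 1 ≤ s ∧ s ≤ 2 * g} →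
      ((g : ℤ) - γ + 1 ≤ (u1 T : ℤ) ∧
        (((g : ℤ) - γ) % 3 = 2 → (g : ℤ) - γ + 2 ≤ (u1 T : ℤ))) := by
  refine ⟨5 * γ, fun g hg T hT hgenus hres => ?_⟩
  obtain ⟨huT, hu⟩ := hT.1.u1_mem
  have hbound : g < γ + u1 T := by
    by_contra! hlt
    refine absurd (hT.genus_lt hu fun k => ?_) (by omega)
    rcases le_or_gt (2 * γ) k with hk | hk
    · exact hT.1.2.1 _ huT _ (hT.three_mul_mem_s8 hk)
    · have hmem : u1 T + 3 * k ∈ resSet g (u1 T % 3) T := by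
        rw [hres]
        exact ⟨⟨k, rfl⟩, by omega, by omega⟩
      exact hmem.1
  omega
end

section
/- Let g ≥ 1, d ≥ 1 and k ≥ 1 be integers, let x_0 ≥ 0, and let T = {x_0, x_0 + d, …, x_0 + kd} be an arithmetic progression such that 2x_0 + kd ≤ 2g < 2x_0 + (k+1)d. Fix 1 ≤ i ≤ k and set S = T ∖ {x_0 + id}. Then #((S+S) ∩ [0,2g]) = #((T+T) ∩ [0,2g]) − 1 if i = 1, while #((S+S) ∩ [0,2g]) = #((T+T) ∩ [0,2g]) if i > 1. -/
/-- The sumset A + A of a set of natural numbers. -/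
def sumset (A : Set ℕ) : Set ℕ := {s | ∃ a ∈ A, ∃ b ∈ A, s = a + b}

theorem sumset_progression_inter {g d k x0 : ℕ}
    (hub : 2 * x0 + k * d ≤ 2 * g) (hub' : 2 * g < 2 * x0 + (k + 1) * d) :
    sumset {s : ℕ | ∃ j ≤ k, s = x0 + j * d} ∩ {s | s ≤ 2 * g} =
      {s | ∃ m ≤ k, s = 2 * x0 + m * d} := by
  ext s
  constructor
  · rintro ⟨⟨_, ⟨a, ha, rfl⟩, _, ⟨b, hb, rfl⟩, rfl⟩, hs⟩
    refine ⟨a + b, ?_, by ring⟩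
    have hlt : (a + b) * d < (k + 1) * d := by
      simp only [Set.mem_ofPred_eq] at hs
      linarith
    exact Nat.lt_succ_iff.mp (lt_of_mul_lt_mul_right hlt (Nat.zero_le d))
  · rintro ⟨m, hm, rfl⟩
    refine ⟨⟨_, ⟨0, Nat.zero_le k, rfl⟩, _, ⟨m, hm, rfl⟩, by ring⟩, ?_⟩
    have := Nat.mul_le_mul_right d hm
    simp only [Set.mem_ofPred_eq]
    omega

theorem sumset_mono {A B : Set ℕ} (h : A ⊆ B) : sumset A ⊆ sumset B := by
  rintro s ⟨a, ha, b, hb, rfl⟩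
  exact ⟨a, h ha, b, h hb, rfl⟩

theorem mem_progression_diff {d k x0 i j : ℕ} (hd : 1 ≤ d) (hj : j ≤ k) (hji : j ≠ i) :
    x0 + j * d ∈ {s : ℕ | ∃ j ≤ k, s = x0 + j * d} \ {x0 + i * d} :=
  ⟨⟨j, hj, rfl⟩, fun h => hji (Nat.eq_of_mul_eq_mul_right hd (Nat.add_left_cancel h))⟩

/-- deleting the i-th term of an arithmetic progression T with
2x₀ + kd ≤ 2g < 2x₀ + (k+1)d changes #((T+T) ∩ [0,2g]) by 1 iff i = 1. -/
theorem stmt10 (g d k x0 : ℕ) (hg : 1 ≤ g) (hd : 1 ≤ d) (hk : 1 ≤ k)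
    (T : Set ℕ) (hT : T = {s : ℕ | ∃ j ≤ k, s = x0 + j * d})
    (hub : 2 * x0 + k * d ≤ 2 * g) (hub' : 2 * g < 2 * x0 + (k + 1) * d)
    (i : ℕ) (hi1 : 1 ≤ i) (hik : i ≤ k)
    (S : Set ℕ) (hS : S = T \ {x0 + i * d}) :
    (i = 1 →
      (sumset S ∩ {s | s ≤ 2 * g}).ncard = (sumset T ∩ {s | s ≤ 2 * g}).ncard - 1) ∧
    (1 < i →
      (sumset S ∩ {s | s ≤ 2 * g}).ncard = (sumset T ∩ {s | s ≤ 2 * g}).ncard) := by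
  subst hT
  have hTT := sumset_progression_inter hub hub'
  have hsub : sumset S ∩ {s | s ≤ 2 * g} ⊆
      sumset {s : ℕ | ∃ j ≤ k, s = x0 + j * d} ∩ {s | s ≤ 2 * g} :=
    Set.inter_subset_inter_left _ (sumset_mono (hS ▸ Set.sdiff_subset))
  subst hS
  refine ⟨fun hi => ?_, fun hi => ?_⟩
  · subst hi
    rw [← Set.ncard_sdiff_singleton_of_mem (a := 2 * x0 + 1 * d) (by rw [hTT]; exact ⟨1, hk, rfl⟩)]
    congr 1
    apply Set.Subset.antisymm
    · refine fun s hs => ⟨hsub hs, ?_⟩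
      obtain ⟨⟨_, ⟨⟨a, -, rfl⟩, ha⟩, _, ⟨⟨b, -, rfl⟩, hb⟩, rfl⟩, -⟩ := hs
      intro h
      have hab : (a + b) * d = 1 * d := by
        rw [Set.mem_singleton_iff] at h
        linarith
      have hab' := Nat.eq_of_mul_eq_mul_right hd hab
      have ha' : a ≠ 1 := by rintro rfl; exact ha rfl
      have hb' : b ≠ 1 := by rintro rfl; exact hb rfl
      omega
    · rintro s ⟨hs, hne⟩
      refine ⟨?_, hs.2⟩
      rw [hTT] at hs
      obtain ⟨m, hm, rfl⟩ := hs
      have hm1 : m ≠ 1 := by rintro rfl; exact hne rfl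
      exact ⟨_, mem_progression_diff hd (Nat.zero_le k) zero_ne_one,
        _, mem_progression_diff hd hm hm1, by ring⟩
  · congr 1
    apply Set.Subset.antisymm hsub
    intro s hs
    refine ⟨?_, hs.2⟩
    rw [hTT] at hs
    obtain ⟨m, hm, rfl⟩ := hs
    by_cases hmi : m = i
    · obtain ⟨n, rfl⟩ := Nat.exists_eq_add_of_le hi1
      subst hmi
      exact ⟨_, mem_progression_diff hd hk (by omega),
        _, mem_progression_diff (j := n) hd (by omega) (by omega), by ring⟩
    · exact ⟨_, mem_progression_diff hd (Nat.zero_le k) (by omega),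
        _, mem_progression_diff hd hm hmi, by ring⟩
end

section
/- For every γ ≥ 0 there exists g₀ such that for all g ≥ g₀ the following holds: set u_1 = g − γ + 1 + ⌊((g−γ) mod 3)/2⌋ and let T be a (3,γ)-hyperelliptic numerical semigroup of genus g with u_1(T) = u_1 and T_{(u_1 mod 3)} = {u_1 + 3k : k ∈ ℕ} ∩ {1,…,2g}. If S is a (3,γ)-hyperelliptic numerical semigroup of genus g with S_0 = T_0 and #S_{(u_1(S) mod 3)} < #T_{(u_1 mod 3)}, then Ĩ_T < Ĩ_S (equivalently W_T > W_S). -/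
open Finset in
/-- A sum over a finite set of naturals, split along residues modulo 3. -/
theorem sum_eq_sum_residues {G : Finset ℕ} {K : ℕ → Finset ℕ}
    (hK : ∀ i < 3, ∀ k, k ∈ K i ↔ 3 * k + i ∈ G) (f : ℕ → ℕ) :
    ∑ n ∈ G, f n = ∑ i ∈ range 3, ∑ k ∈ K i, f (3 * k + i) := by
  rw [Finset.sum_sigma']
  refine Finset.sum_bij' (fun n _ => (⟨n % 3, n / 3⟩ : Σ _ : ℕ, ℕ)) (fun p _ => 3 * p.2 + p.1)
    ?_ ?_ ?_ ?_ ?_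
  · intro n hn
    simp only [mem_sigma, mem_range]
    refine ⟨Nat.mod_lt _ (by norm_num), (hK _ (Nat.mod_lt _ (by norm_num)) _).2 ?_⟩
    rwa [Nat.div_add_mod]
  · rintro ⟨i, k⟩ hp
    simp only [mem_sigma, mem_range] at hp
    exact (hK i hp.1 k).1 hp.2
  · intro n _
    exact Nat.div_add_mod n 3
  · rintro ⟨i, k⟩ hp
    simp only [mem_sigma, mem_range] at hp
    have h1 : (3 * k + i) % 3 = i := by omega
    have h2 : (3 * k + i) / 3 = k := by omega
    simp only [h1, h2]
  · intro n _
    rw [Nat.div_add_mod]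

open Finset Classical in
/-- If `n` is a gap of an additively closed set, then at least half of `{0, …, n}` are gaps. -/
theorem succ_le_two_mul_card_gaps {S : Set ℕ} (hS : ∀ a ∈ S, ∀ b ∈ S, a + b ∈ S) {n : ℕ}
    (hn : n ∉ S) : n + 1 ≤ 2 * #{k ∈ range (n + 1) | k ∉ S} := by
  have h1 := card_filter_add_card_filter_not (s := range (n + 1)) (fun k => k ∈ S)
  have h2 : #{k ∈ range (n + 1) | k ∈ S} ≤ #{k ∈ range (n + 1) | k ∉ S} := by
    refine card_le_card_of_injOn (fun k => n - k) ?_ ?_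
    · intro k hk
      simp only [coe_filter, mem_range, Set.mem_ofPred_eq] at hk ⊢
      refine ⟨by omega, fun h => hn ?_⟩
      have := hS _ hk.2 _ h
      rwa [Nat.add_sub_cancel' (by omega)] at this
    · intro a ha b hb hab
      simp only [coe_filter, mem_range, Set.mem_ofPred_eq] at ha hb hab
      omega
  rw [card_range] at h1
  omega

open Finset Classical in
/-- An additively closed set with `γ` gaps in `{0, …, 2γ}` that contains `2γ` and `2γ + 1`
contains every `n ≥ 2γ`. -/
theorem mem_of_two_mul_le {P : Set ℕ} (hP : ∀ a ∈ P, ∀ b ∈ P, a + b ∈ P) {γ : ℕ}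
    (hcard : #{k ∈ range (2 * γ + 1) | k ∉ P} = γ) (h0 : 2 * γ ∈ P) (h1 : 2 * γ + 1 ∈ P)
    (n : ℕ) (hn : 2 * γ ≤ n) : n ∈ P := by
  induction n using Nat.strong_induction_on with
  | _ n ih =>
    by_contra hnP
    have h2 := succ_le_two_mul_card_gaps hP hnP
    have h3 : ({k ∈ range (n + 1) | k ∉ P} : Finset ℕ) ⊆
        insert n {k ∈ range (2 * γ + 1) | k ∉ P} := by
      intro k hk
      simp only [mem_filter, mem_range, mem_insert] at hk ⊢
      by_cases hkn : k = n
      · exact Or.inl hkn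
      · refine Or.inr ⟨?_, hk.2⟩
        by_contra hk'
        exact hk.2 (ih k (by omega) (by omega))
    have h4 := (card_le_card h3).trans (card_insert_le _ _)
    have h5 : n ≠ 2 * γ := by rintro rfl; exact hnP h0
    have h6 : n ≠ 2 * γ + 1 := by rintro rfl; exact hnP h1
    omega

open Finset in
theorem two_mul_sum_range_cast_s11 (m : ℕ) : 2 * ∑ k ∈ range m, (k : ℤ) = m * (m - 1) := by
  induction m with
  | zero => simp
  | succ n ih => rw [sum_range_succ, mul_add, ih]; push_cast; ring

open Finset in
theorem card_mul_pred_le_two_mul_sum (K : Finset ℕ) :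
    (#K : ℤ) * (#K - 1) ≤ 2 * ∑ k ∈ K, (k : ℤ) := by
  rw [← two_mul_sum_range_cast_s11]
  have h := sum_range_le_sum (s := K.map Nat.castEmbedding) (c := 0) (by simp)
  simp only [card_map, zero_add, sum_map, Nat.castEmbedding_apply] at h
  linarith

open Finset in
/-- A finite set of naturals caught between `{0, …, m - 1}` and `{0, …, m + c - 1}` has almost
the least possible sum for its cardinality. -/
theorem two_mul_sum_le {K : Finset ℕ} {m c : ℕ} (hlow : range m ⊆ K) (hup : K ⊆ range (m + c)) :
    2 * (∑ k ∈ K, k : ℤ) ≤ (#K : ℤ) * (#K - 1) + 2 * c ^ 2 := by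
  have hsum := sum_sdiff (f := fun k : ℕ => (k : ℤ)) hlow
  have hcard := card_sdiff_add_card_eq_card hlow
  rw [card_range] at hcard
  have hle : #(K \ range m) ≤ c := by
    have := card_le_card hup
    rw [card_range] at this
    omega
  have hE : ∑ k ∈ K \ range m, (k : ℤ) ≤ #(K \ range m) • ((m + c : ℕ) : ℤ) := by
    refine sum_le_card_nsmul _ _ _ fun k hk => ?_
    have := hup (sdiff_subset hk)
    rw [mem_range] at this
    exact_mod_cast this.le
  have hgauss := two_mul_sum_range_cast_s11 m
  rw [nsmul_eq_mul] at hE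
  rw [← hsum, ← hcard]
  generalize #(K \ range m) = e at *
  push_cast at hE ⊢
  have he : (e : ℤ) ≤ c := by exact_mod_cast hle
  have he0 : (0 : ℤ) ≤ e := by positivity
  have hee : (e : ℤ) ≤ e * e := by exact_mod_cast Nat.le_mul_self e
  nlinarith

open Classical in
/-- The indices `k ≤ 2g` such that `3k + i` is a gap of `S`. -/
noncomputable def gapIndex (g : ℕ) (S : Set ℕ) (i : ℕ) : Finset ℕ :=
  (Finset.range (2 * g + 1)).filter fun k => 3 * k + i ∉ S

open Classical in
/-- The gaps of `S` that are at most `2g`. -/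
noncomputable def gapFinset (g : ℕ) (S : Set ℕ) : Finset ℕ :=
  (Finset.range (2 * g + 1)).filter fun k => k ∉ S

section Genus

open Finset

variable {g : ℕ} {S : Set ℕ}

theorem gap_lt_two_mul (hS : IsNumericalSemigroup S) (hg : genus S = g) {n : ℕ} (hn : n ∉ S) :
    n < 2 * g := by
  classical
  have h1 := succ_le_two_mul_card_gaps hS.2.1 hn
  have h2 : #{k ∈ range (n + 1) | k ∉ S} ≤ g := by
    rw [← hg, genus, ← Set.ncard_coe_finset]
    refine Set.ncard_le_ncard ?_ hS.2.2
    intro k hk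
    simp only [coe_filter, Set.mem_ofPred_eq] at hk
    exact hk.2
  omega

theorem mem_gapIndex (hS : IsNumericalSemigroup S) (hg : genus S = g) {i k : ℕ} :
    k ∈ gapIndex g S i ↔ 3 * k + i ∉ S := by
  classical
  simp only [gapIndex, mem_filter, mem_range, and_iff_right_iff_imp]
  intro h
  have := gap_lt_two_mul hS hg h
  omega

theorem mem_gapFinset (hS : IsNumericalSemigroup S) (hg : genus S = g) {n : ℕ} :
    n ∈ gapFinset g S ↔ n ∉ S := by
  classical
  simp only [gapFinset, mem_filter, mem_range, and_iff_right_iff_imp]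
  intro h
  have := gap_lt_two_mul hS hg h
  omega

theorem coe_gapFinset (hS : IsNumericalSemigroup S) (hg : genus S = g) :
    (gapFinset g S : Set ℕ) = Sᶜ := by
  ext n
  exact mem_gapFinset hS hg

theorem card_gapFinset (hS : IsNumericalSemigroup S) (hg : genus S = g) :
    #(gapFinset g S) = g := by
  rw [← Set.ncard_coe_finset, coe_gapFinset hS hg]
  exact hg

theorem sum_gapFinset (hS : IsNumericalSemigroup S) (hg : genus S = g) (f : ℕ → ℕ) :
    ∑ n ∈ gapFinset g S, f n = ∑ i ∈ range 3, ∑ k ∈ gapIndex g S i, f (3 * k + i) :=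
  sum_eq_sum_residues (fun i _ k => by rw [mem_gapIndex hS hg, mem_gapFinset hS hg]) f

theorem card_gapIndex_add (hS : IsNumericalSemigroup S) (hg : genus S = g) :
    #(gapIndex g S 0) + #(gapIndex g S 1) + #(gapIndex g S 2) = g := by
  have h := sum_gapFinset hS hg fun _ => 1
  simp only [sum_const, smul_eq_mul, mul_one, card_gapFinset hS hg] at h
  simpa [sum_range_succ] using h.symm

theorem sum_gaps_eq (hS : IsNumericalSemigroup S) (hg : genus S = g) :
    ∑ n ∈ gapFinset g S, n =
      3 * (∑ k ∈ gapIndex g S 0, k) + (3 * (∑ k ∈ gapIndex g S 1, k) + #(gapIndex g S 1)) +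
        (3 * (∑ k ∈ gapIndex g S 2, k) + 2 * #(gapIndex g S 2)) := by
  rw [sum_gapFinset hS hg fun n => n]
  simp only [sum_range_succ, sum_range_zero, sum_add_distrib, mul_sum, sum_const, smul_eq_mul]
  ring

theorem weight_eq (hS : IsNumericalSemigroup S) (hg : genus S = g) :
    weight S = ((∑ n ∈ gapFinset g S, n : ℕ) : ℤ) - (g * (g + 1)) / 2 := by
  rw [weight, hg, ← coe_gapFinset hS hg, finsum_mem_coe_finset, Nat.cast_sum]

theorem inflection_add_sum_gaps (g : ℕ) (S : Set ℕ) :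
    inflection g S + ∑ n ∈ gapFinset g S, n = ∑ n ∈ range (2 * g + 1), n := by
  classical
  have h : {s ∈ S | 1 ≤ s ∧ s ≤ 2 * g} =
      ↑(({n ∈ range (2 * g + 1) | n ∈ S} : Finset ℕ).erase 0) := by
    ext n
    simp only [coe_erase, coe_filter, mem_range, Set.mem_ofPred_eq, Set.mem_sdiff,
      Set.mem_singleton_iff]
    constructor
    · rintro ⟨h1, h2, h3⟩; exact ⟨⟨by omega, h1⟩, by omega⟩
    · rintro ⟨⟨h1, h2⟩, h3⟩; exact ⟨h2, by omega, by omega⟩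
  rw [inflection, h, finsum_mem_coe_finset, sum_erase (f := fun n => n) _ rfl, gapFinset,
    sum_filter_add_sum_filter_not]

theorem ncard_resSet_add (hS : IsNumericalSemigroup S) (hg : genus S = g) {i : ℕ} (hi : 0 < i)
    (hi3 : i < 3) : (resSet g i S).ncard + #(gapIndex g S i) = (2 * g + 3 - i) / 3 := by
  classical
  have h : resSet g i S =
      (({k ∈ range ((2 * g + 3 - i) / 3) | 3 * k + i ∈ S} : Finset ℕ).image
        (fun k => 3 * k + i) : Set ℕ) := by
    ext n
    simp only [resSet, coe_image, coe_filter, mem_range, Set.mem_ofPred_eq, Set.mem_image]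
    constructor
    · rintro ⟨h1, h2, h3, h4⟩
      have h5 : 3 * (n / 3) + i = n := by omega
      exact ⟨n / 3, ⟨by omega, by rwa [h5]⟩, h5⟩
    · rintro ⟨k, ⟨h1, h2⟩, rfl⟩
      exact ⟨h2, by omega, by omega, by omega⟩
  have h' : gapIndex g S i = {k ∈ range ((2 * g + 3 - i) / 3) | ¬ 3 * k + i ∈ S} := by
    ext k
    simp only [mem_gapIndex hS hg, mem_filter, mem_range, iff_and_self]
    intro h
    have := gap_lt_two_mul hS hg h
    omega
  rw [h, Set.ncard_coe_finset, card_image_of_injective _ (fun a b => by simp), h',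
    card_filter_add_card_filter_not, card_range]

theorem u1_spec (hS : IsNumericalSemigroup S) : u1 S ∈ S ∧ ¬ 3 ∣ u1 S := by
  have hne : {s ∈ S | ¬ 3 ∣ s}.Nonempty := by
    refine ⟨3 * genus S + 1, ?_, by omega⟩
    by_contra h
    have := gap_lt_two_mul hS rfl h
    omega
  exact Nat.sInf_mem hne

theorem u1_le {s : ℕ} (hs : s ∈ S) (h3 : ¬ 3 ∣ s) : u1 S ≤ s :=
  Nat.sInf_le ⟨hs, h3⟩

end Genus

section Hyperelliptic

open Finset

variable {γ g : ℕ} {S : Set ℕ}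

open Classical in
theorem card_filter_three_mul_notMem (h : IsNgammaHyperelliptic 3 γ S) :
    #{k ∈ range (2 * γ + 1) | 3 * k ∉ S} = γ := by
  obtain ⟨hS, hcard, hdvd, h0, h1⟩ := h
  have hset : {s ∈ S | 0 < s ∧ s ≤ 2 * γ * 3} =
      (({k ∈ range (2 * γ + 1) | 3 * k ∈ S} : Finset ℕ).erase 0).image (fun k => 3 * k) := by
    ext s
    simp only [coe_image, coe_erase, coe_filter, mem_range, Set.mem_ofPred_eq, Set.mem_image,
      Set.mem_sdiff, Set.mem_singleton_iff]
    constructor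
    · rintro ⟨hs, hs0, hsle⟩
      obtain ⟨k, rfl⟩ := hdvd s hs hs0 hsle
      exact ⟨k, ⟨⟨by omega, hs⟩, by omega⟩, rfl⟩
    · rintro ⟨k, ⟨⟨hk, hkS⟩, hk0⟩, rfl⟩
      exact ⟨hkS, by omega, by omega⟩
  rw [hset, Set.ncard_coe_finset, card_image_of_injective _ (fun a b => by simp),
    card_erase_of_mem (by simpa using hS.1)] at hcard
  have hsplit := card_filter_add_card_filter_not (s := range (2 * γ + 1)) (fun k => 3 * k ∈ S)
  have hpos : 0 < #{k ∈ range (2 * γ + 1) | 3 * k ∈ S} := card_pos.2 ⟨0, by simpa using hS.1⟩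
  rw [card_range] at hsplit
  omega

theorem three_mul_mem (h : IsNgammaHyperelliptic 3 γ S) {n : ℕ} (hn : 2 * γ ≤ n) :
    3 * n ∈ S := by
  refine mem_of_two_mul_le (P := {n | 3 * n ∈ S}) ?_ (card_filter_three_mul_notMem h) ?_ ?_ n hn
  · intro a ha b hb
    have := h.1.2.1 _ ha _ hb
    rwa [← mul_add] at this
  · change 3 * (2 * γ) ∈ S
    rw [mul_comm]
    exact h.2.2.2.1
  · change 3 * (2 * γ + 1) ∈ S
    rw [mul_comm]
    exact h.2.2.2.2

theorem card_gapIndex_zero (h : IsNgammaHyperelliptic 3 γ S) (hg : genus S = g) :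
    #(gapIndex g S 0) = γ := by
  classical
  rw [← card_filter_three_mul_notMem h]
  congr 1
  ext k
  simp only [mem_gapIndex h.1 hg, add_zero, mem_filter, mem_range, iff_and_self]
  intro hk
  by_contra hlt
  exact hk (three_mul_mem h (by omega))

theorem exists_gapIndex_bounds (h : IsNgammaHyperelliptic 3 γ S) (hg : genus S = g) (i : ℕ) :
    ∃ m, 3 * m + i ∈ S ∧ range m ⊆ gapIndex g S i ∧ gapIndex g S i ⊆ range (m + 2 * γ) := by
  classical
  have hex : ∃ m, 3 * m + i ∈ S := by
    refine ⟨g, ?_⟩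
    by_contra hgap
    have := gap_lt_two_mul h.1 hg hgap
    omega
  refine ⟨Nat.find hex, Nat.find_spec hex, ?_, ?_⟩
  · intro k hk
    rw [mem_range] at hk
    exact (mem_gapIndex h.1 hg).2 (Nat.find_min hex hk)
  · intro k hk
    rw [mem_gapIndex h.1 hg] at hk
    rw [mem_range]
    by_contra hlt
    have h3 := h.1.2.1 _ (Nat.find_spec hex) _
      (three_mul_mem h (n := k - Nat.find hex) (by omega))
    have h4 : 3 * Nat.find hex + i + 3 * (k - Nat.find hex) = 3 * k + i := by omega
    exact hk (h4 ▸ h3)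

theorem two_mul_sum_gapIndex_le (h : IsNgammaHyperelliptic 3 γ S) (hg : genus S = g) (i : ℕ) :
    2 * (∑ k ∈ gapIndex g S i, k : ℤ) ≤
      (#(gapIndex g S i) : ℤ) * (#(gapIndex g S i) - 1) + 8 * γ ^ 2 := by
  obtain ⟨m, -, hlow, hup⟩ := exists_gapIndex_bounds h hg i
  have := two_mul_sum_le hlow hup
  push_cast at this
  linarith

/-- The residue class of `u1 S` has at most `2γ` more gaps than the other nonzero class. -/
theorem card_gapIndex_u1_le (h : IsNgammaHyperelliptic 3 γ S) (hg : genus S = g) :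
    #(gapIndex g S (u1 S % 3)) ≤ #(gapIndex g S (3 - u1 S % 3)) + 2 * γ := by
  obtain ⟨m, hmS, hlow, hup⟩ := exists_gapIndex_bounds h hg (u1 S % 3)
  have hu := u1_spec h.1
  have hm : m ≤ u1 S / 3 := by
    by_contra hlt
    have := hlow (mem_range.2 (not_le.1 hlt))
    rw [mem_gapIndex h.1 hg, Nat.div_add_mod] at this
    exact this hu.1
  have hother : range m ⊆ gapIndex g S (3 - u1 S % 3) := by
    intro k hk
    rw [mem_range] at hk
    rw [mem_gapIndex h.1 hg]
    intro hkS
    have := u1_le hkS (by omega)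
    omega
  have h1 := card_le_card hother
  have h2 := card_le_card hup
  rw [card_range] at h1 h2
  omega

theorem card_gapIndex_of_resSet_eq (h : IsNumericalSemigroup S) (hg : genus S = g)
    (hres : resSet g (u1 S % 3) S =
      {s : ℕ | (∃ k : ℕ, s = u1 S + 3 * k) ∧ 1 ≤ s ∧ s ≤ 2 * g}) :
    #(gapIndex g S (u1 S % 3)) = u1 S / 3 := by
  have hu := u1_spec h
  rw [← card_range (u1 S / 3)]
  congr 1
  ext k
  rw [mem_gapIndex h hg, mem_range]
  constructor
  · intro hk
    by_contra hlt
    have hlt2 := gap_lt_two_mul h hg hk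
    have hmem : 3 * k + u1 S % 3 ∈ resSet g (u1 S % 3) S := by
      rw [hres]
      exact ⟨⟨k - u1 S / 3, by omega⟩, by omega, by omega⟩
    exact hk hmem.1
  · intro hk hkS
    have := u1_le hkS (by omega)
    omega

/-- Twice the least possible gap sum when the classes `0`, `r`, `3 - r` modulo 3 carry `c`, `a`,
`b` gaps respectively. -/
def gapMainTerm (c a b r : ℤ) : ℤ :=
  3 * (c * (c - 1)) + (3 * (a * (a - 1)) + 2 * r * a) + (3 * (b * (b - 1)) + 2 * (3 - r) * b)

theorem two_mul_sum_gaps_eq (h : IsNgammaHyperelliptic 3 γ S) (hg : genus S = g) {r : ℕ}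
    (hr : r = 1 ∨ r = 2) :
    2 * ((∑ n ∈ gapFinset g S, n : ℕ) : ℤ) =
      3 * (2 * ∑ k ∈ gapIndex g S 0, (k : ℤ)) +
        (3 * (2 * ∑ k ∈ gapIndex g S r, (k : ℤ)) + 2 * r * #(gapIndex g S r)) +
        (3 * (2 * ∑ k ∈ gapIndex g S (3 - r), (k : ℤ)) + 2 * (3 - r) * #(gapIndex g S (3 - r))) := by
  rw [sum_gaps_eq h.1 hg]
  rcases hr with rfl | rfl <;> push_cast <;> ring

theorem two_mul_sum_gaps_le (h : IsNgammaHyperelliptic 3 γ S) (hg : genus S = g) {r : ℕ}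
    (hr : r = 1 ∨ r = 2) :
    2 * ((∑ n ∈ gapFinset g S, n : ℕ) : ℤ) ≤
      gapMainTerm γ #(gapIndex g S r) #(gapIndex g S (3 - r)) r + 72 * γ ^ 2 := by
  have h0 := two_mul_sum_gapIndex_le h hg 0
  rw [card_gapIndex_zero h hg] at h0
  have h1 := two_mul_sum_gapIndex_le h hg r
  have h2 := two_mul_sum_gapIndex_le h hg (3 - r)
  rw [two_mul_sum_gaps_eq h hg hr, gapMainTerm]
  linarith

theorem gapMainTerm_le (h : IsNgammaHyperelliptic 3 γ S) (hg : genus S = g) {r : ℕ}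
    (hr : r = 1 ∨ r = 2) :
    gapMainTerm γ #(gapIndex g S r) #(gapIndex g S (3 - r)) r ≤
      2 * ((∑ n ∈ gapFinset g S, n : ℕ) : ℤ) := by
  have h0 := card_mul_pred_le_two_mul_sum (gapIndex g S 0)
  rw [card_gapIndex_zero h hg] at h0
  have h1 := card_mul_pred_le_two_mul_sum (gapIndex g S r)
  have h2 := card_mul_pred_le_two_mul_sum (gapIndex g S (3 - r))
  rw [two_mul_sum_gaps_eq h hg hr, gapMainTerm]
  linarith

end Hyperelliptic

/-- Moving gaps from the larger residue class to the smaller one lowers the main term. -/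
theorem gapMainTerm_add_lt {n c a a' r r' C : ℤ} (hr : r = 1 ∨ r = 2) (hr' : r' = 1 ∨ r' = 2)
    (hle : a ≤ a') (hlt : r' ≤ r → a < a') (hC0 : 0 ≤ C) (hC : C < 2 * (n - a - a')) :
    gapMainTerm c a' (n - a') r' + C < gapMainTerm c a (n - a) r := by
  unfold gapMainTerm
  rcases hr with rfl | rfl <;> rcases hr' with rfl | rfl <;> norm_num at hlt <;>
    nlinarith [mul_nonneg (sub_nonneg.2 hle) (show 0 ≤ n - a - a' by linarith)]

/-- the semigroup T of maximal-size residue set beats any S with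
the same residue-0 part and smaller residue set: Ĩ_T < Ĩ_S. -/
theorem stmt11 (γ : ℕ) :
    ∃ g₀ : ℕ, ∀ g ≥ g₀, ∀ T : Set ℕ,
      IsNgammaHyperelliptic 3 γ T → genus T = g →
      (u1 T : ℤ) = (g : ℤ) - γ + 1 + (((g : ℤ) - γ) % 3) / 2 →
      resSet g (u1 T % 3) T =
        {s : ℕ | (∃ k : ℕ, s = u1 T + 3 * k) ∧ 1 ≤ s ∧ s ≤ 2 * g} →
      ∀ S : Set ℕ, IsNgammaHyperelliptic 3 γ S → genus S = g →
        resSet g 0 S = resSet g 0 T →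
        (resSet g (u1 S % 3) S).ncard < (resSet g (u1 T % 3) T).ncard →
        inflection g T < inflection g S ∧ weight S < weight T := by
  open Finset in
  refine ⟨216 * γ ^ 2 + 20 * γ + 100, ?_⟩
  intro g hg T hT hgT huT hresT S hS hgS _ hlt
  have hgaps : ∑ n ∈ gapFinset g S, n < ∑ n ∈ gapFinset g T, n := by
    have hcT := card_gapIndex_of_resSet_eq hT.1 hgT hresT
    have hleS := card_gapIndex_u1_le hS hgS
    have huS3 := (u1_spec hS.1).2
    have huT3 := (u1_spec hT.1).2
    have hresS := ncard_resSet_add hS.1 hgS (i := u1 S % 3) (by omega) (by omega)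
    have hresT' := ncard_resSet_add hT.1 hgT (i := u1 T % 3) (by omega) (by omega)
    have h0S := card_gapIndex_zero hS hgS
    have h0T := card_gapIndex_zero hT hgT
    have hsumS := card_gapIndex_add hS.1 hgS
    have hsumT := card_gapIndex_add hT.1 hgT
    have hrS : u1 S % 3 = 1 ∨ u1 S % 3 = 2 := by omega
    have hrT : u1 T % 3 = 1 ∨ u1 T % 3 = 2 := by omega
    have hupS := two_mul_sum_gaps_le hS hgS hrS
    have hlowT := gapMainTerm_le hT hgT hrT
    have hbS : #(gapIndex g S (u1 S % 3)) + #(gapIndex g S (3 - u1 S % 3)) = g - γ := by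
      rcases hrS with h | h <;> simp only [h, Nat.reduceSub] <;> omega
    have hbT : #(gapIndex g T (u1 T % 3)) + #(gapIndex g T (3 - u1 T % 3)) = g - γ := by
      rcases hrT with h | h <;> simp only [h, Nat.reduceSub] <;> omega
    have hgZ : 216 * (γ : ℤ) ^ 2 + 20 * γ + 100 ≤ g := by exact_mod_cast hg
    have hsq : 0 ≤ (γ : ℤ) ^ 2 := by positivity
    have hγg : γ ≤ g := by omega
    have hleT : 3 * (#(gapIndex g T (u1 T % 3)) : ℤ) ≤ g - γ + 4 := by clear hupS hlowT; omega
    have hleS' : 2 * (#(gapIndex g S (u1 S % 3)) : ℤ) ≤ g + γ := by clear hupS hlowT; omega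
    have hle : #(gapIndex g T (u1 T % 3)) ≤ #(gapIndex g S (u1 S % 3)) := by
      clear hupS hlowT hgZ hleT hleS' huT hg
      rcases hrS with h | h <;> rcases hrT with h' | h' <;> rw [h] at hresS hlt ⊢ <;>
        rw [h'] at hresT' hlt ⊢ <;> omega
    have hlt' : u1 S % 3 ≤ u1 T % 3 →
        #(gapIndex g T (u1 T % 3)) < #(gapIndex g S (u1 S % 3)) := by
      clear hupS hlowT hgZ hleT hleS' huT hg
      rcases hrS with h | h <;> rcases hrT with h' | h' <;> rw [h] at hresS hlt ⊢ <;>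
        rw [h'] at hresT' hlt ⊢ <;> omega
    have hcmp := gapMainTerm_add_lt (n := (g : ℤ) - γ) (c := γ) (a := #(gapIndex g T (u1 T % 3)))
      (a' := #(gapIndex g S (u1 S % 3))) (r := (u1 T % 3 : ℕ)) (r' := (u1 S % 3 : ℕ))
      (C := 72 * γ ^ 2) (by exact_mod_cast hrT) (by exact_mod_cast hrS) (by exact_mod_cast hle)
      (by exact_mod_cast hlt') (by positivity) (by linarith)
    rw [show (#(gapIndex g S (3 - u1 S % 3)) : ℤ) = (g : ℤ) - γ - #(gapIndex g S (u1 S % 3)) by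
      omega] at hupS
    rw [show (#(gapIndex g T (3 - u1 T % 3)) : ℤ) = (g : ℤ) - γ - #(gapIndex g T (u1 T % 3)) by
      omega] at hlowT
    exact_mod_cast (by linarith : ((∑ n ∈ gapFinset g S, n : ℕ) : ℤ) <
      (∑ n ∈ gapFinset g T, n : ℕ))
  have hiS := inflection_add_sum_gaps g S
  have hiT := inflection_add_sum_gaps g T
  refine ⟨by omega, ?_⟩
  rw [weight_eq hS.1 hgS, weight_eq hT.1 hgT]
  have : ((∑ n ∈ gapFinset g S, n : ℕ) : ℤ) < (∑ n ∈ gapFinset g T, n : ℕ) := by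
    exact_mod_cast hgaps
  linarith
end
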